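/- arXiv:2410.15599 — 6 statements merged into one kernel-verified Lean document; each statement's English description precedes it below -/
import Mathlib

section
/- Fix 0 < β < ∞. The family of probability measures {T_{μ,β}(λ) : μ a Borel probability measure on Σ, λ ∈ Pr₁} is tight: for every ε > 0 there exist constants C, L > 0 such that for every Borel probability measure μ on Σ and every λ ∈ Pr₁, the measure T_{μ,β}(λ) assigns mass at least 1 − ε to the set K(C,L) = {f ∈ C(Σ,ℝ) : ‖f‖∞ ≤ C and f is Lipschitz with constant L} (which is compact in C(Σ,ℝ) by the Arzelà–Ascoli theorem). -/
open MeasureTheory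
open scoped ENNReal NNReal

namespace DilutedSpinGlass

variable {S : Set ℝ}

/-- `E_{β,r}(σ,t) = exp(β Σ_{k=1}^r θ_k(σ_{k,1},…,σ_{k,p-1},t) + β ψ(t))`, the cavity
coordinates being indexed by pairs `(k,j) ∈ Fin r × Fin (p-1)`. -/
noncomputable def engFactor (p : ℕ) (β : ℝ) (ψ : C(↥S, ℝ)) {r : ℕ}
    (θv : Fin r → C((Fin p → ↥S), ℝ)) (σ : Fin r × Fin (p - 1) → ↥S) (t : ↥S) : ℝ :=
  Real.exp (β * ((∑ k : Fin r,
    θv k (fun j : Fin p => if h : (j : ℕ) < p - 1 then σ (k, ⟨(j : ℕ), h⟩) else t)) + ψ t))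

/-- The value at `t ∈ Σ` of the random function `T_{μ,β,r}((θ_k)_k, (X_i)_i)`. -/
noncomputable def opVal (p : ℕ) (β : ℝ) (ψ : C(↥S, ℝ)) (μ : Measure ↥S) {r : ℕ}
    (θv : Fin r → C((Fin p → ↥S), ℝ)) (Xv : Fin r × Fin (p - 1) → C(↥S, ℝ)) (t : ↥S) : ℝ :=
  (1 / β) * Real.log
    ((∫ σ, engFactor p β ψ θv σ t * ∏ i, Real.exp (β * Xv i (σ i))
        ∂(Measure.pi fun _ : Fin r × Fin (p - 1) => μ)) /
      (∫ σ, (∫ s, engFactor p β ψ θv σ s ∂μ) * ∏ i, Real.exp (β * Xv i (σ i))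
        ∂(Measure.pi fun _ : Fin r × Fin (p - 1) => μ)))

/-- Membership in `Pr₁(X)`: a Borel probability measure with integrable norm. -/
def MemPr1 [MeasurableSpace C(↥S, ℝ)] [CompactSpace ↥S] (lam : Measure C(↥S, ℝ)) : Prop :=
  IsProbabilityMeasure lam ∧ Integrable (fun f => ‖f‖) lam

/-- `T` is (a version of) the distributional operator `T_{μ,β}`. -/
def IsCavityOp (p : ℕ) (α : ℝ≥0) (β : ℝ) (ψ : C(↥S, ℝ)) [CompactSpace ↥S]
    [MeasurableSpace C((Fin p → ↥S), ℝ)] [MeasurableSpace C(↥S, ℝ)]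
    (μθ : Measure C((Fin p → ↥S), ℝ)) (μ : Measure ↥S)
    (T : Measure C(↥S, ℝ) → Measure C(↥S, ℝ)) : Prop :=
  ∀ lam : Measure C(↥S, ℝ), MemPr1 lam →
    ∀ A : Set C(↥S, ℝ), MeasurableSet A →
      T lam A = ∑' r : ℕ, (ProbabilityTheory.poissonMeasure (α * p)) {r} *
        ((Measure.pi fun _ : Fin r => μθ).prod
            (Measure.pi fun _ : Fin r × Fin (p - 1) => lam))
          {q | (fun t => opVal p β ψ μ q.1 q.2 t) ∈ DFunLike.coe '' A}

/-- The (extended-real) Lipschitz seminorm of a function on `Σ^p`, with respect to the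
Euclidean distance on `Σ^p`. -/
noncomputable def eLipEuc (p : ℕ) [CompactSpace ↥S] (θ : C((Fin p → ↥S), ℝ)) : ℝ≥0∞ :=
  ⨆ x : Fin p → ↥S, ⨆ y : Fin p → ↥S,
    edist (θ x) (θ y) / ENNReal.ofReal (Real.sqrt (∑ j, ((x j : ℝ) - (y j : ℝ)) ^ 2))

/-- A function with Lipschitz seminorm at most `M` for the Euclidean distance satisfies the
corresponding pointwise bound. -/
theorem abs_sub_le_of_eLipEuc_le {p : ℕ} [CompactSpace ↥S] {θ : C((Fin p → ↥S), ℝ)} {M : ℝ≥0}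
    (h : eLipEuc p θ ≤ M) (x y : Fin p → ↥S) :
    |θ x - θ y| ≤ M * Real.sqrt (∑ j, ((x j : ℝ) - (y j : ℝ)) ^ 2) := by
  rcases eq_or_ne x y with rfl | hxy
  · simp
  set d := Real.sqrt (∑ j, ((x j : ℝ) - (y j : ℝ)) ^ 2) with hd
  have hdpos : 0 < d := by
    obtain ⟨j, hj⟩ := Function.ne_iff.1 hxy
    have hj' : (x j : ℝ) - y j ≠ 0 := sub_ne_zero.2 fun h => hj (Subtype.ext h)
    exact Real.sqrt_pos.2 (Finset.sum_pos' (fun i _ => sq_nonneg _)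
      ⟨j, Finset.mem_univ j, by positivity⟩)
  have h1 : edist (θ x) (θ y) / ENNReal.ofReal d ≤ M :=
    (le_iSup₂ (f := fun x y : Fin p → ↥S => edist (θ x) (θ y) /
      ENNReal.ofReal (Real.sqrt (∑ j, ((x j : ℝ) - (y j : ℝ)) ^ 2))) x y).trans h
  rw [ENNReal.div_le_iff (by simpa using hdpos) ENNReal.ofReal_ne_top, edist_dist,
    ← ENNReal.ofReal_coe_nnreal, ← ENNReal.ofReal_mul M.coe_nonneg,
    ENNReal.ofReal_le_ofReal_iff (by positivity)] at h1
  simpa [Real.dist_eq] using h1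

theorem measurable_eLipEuc (p : ℕ) [CompactSpace ↥S]
    [MeasurableSpace C((Fin p → ↥S), ℝ)] [BorelSpace C((Fin p → ↥S), ℝ)] :
    Measurable (eLipEuc (S := S) p) := by
  refine LowerSemicontinuous.measurable ?_
  refine lowerSemicontinuous_iSup fun x => lowerSemicontinuous_iSup fun y => ?_
  have hc : Continuous fun θ : C((Fin p → ↥S), ℝ) => edist (θ x) (θ y) :=
    (continuous_eval_const x).edist (continuous_eval_const y)
  rcases eq_or_ne (ENNReal.ofReal (Real.sqrt (∑ j, ((x j : ℝ) - (y j : ℝ)) ^ 2))) 0 with h0 | h0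
  · have hxy : x = y := by
      have h1 : ∑ j, ((x j : ℝ) - (y j : ℝ)) ^ 2 = 0 := by
        refine le_antisymm ?_ (Finset.sum_nonneg fun _ _ => sq_nonneg _)
        rwa [ENNReal.ofReal_eq_zero, Real.sqrt_le_left le_rfl, zero_pow two_ne_zero] at h0
      funext j
      have h2 := (Finset.sum_eq_zero_iff_of_nonneg fun _ _ => sq_nonneg _).1 h1 j
        (Finset.mem_univ j)
      exact Subtype.ext (sub_eq_zero.1 (pow_eq_zero_iff two_ne_zero |>.1 h2))
    simpa [hxy] using lowerSemicontinuous_const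
  · exact (ENNReal.continuous_div_const _ h0 |>.comp hc).lowerSemicontinuous

/-- Interactions with norm and Lipschitz seminorm both bounded by `M`. -/
def boundedInteractions (S : Set ℝ) [CompactSpace ↥S] (p : ℕ) (M : ℝ≥0) :
    Set C((Fin p → ↥S), ℝ) :=
  {θ | ‖θ‖ ≤ M ∧ eLipEuc p θ ≤ M}

theorem tendsto_measure_boundedInteractions (p : ℕ) [CompactSpace ↥S]
    [MeasurableSpace C((Fin p → ↥S), ℝ)] [BorelSpace C((Fin p → ↥S), ℝ)]
    (μθ : Measure C((Fin p → ↥S), ℝ)) [IsProbabilityMeasure μθ]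
    (hLip : ∫⁻ θ, eLipEuc p θ ∂μθ ≠ ⊤) :
    Filter.Tendsto (fun M : ℕ => μθ (boundedInteractions S p M)) Filter.atTop (nhds 1) := by
  have hmono : Monotone fun M : ℕ => boundedInteractions S p M := by
    intro M N hMN θ hθ
    have hMN' : ((M : ℝ≥0) : ℝ) ≤ (N : ℝ≥0) := by exact_mod_cast hMN
    exact ⟨hθ.1.trans hMN', hθ.2.trans (by exact_mod_cast hMN)⟩
  have hU : μθ (⋃ M : ℕ, boundedInteractions S p M) = 1 := by
    rw [← measure_univ (μ := μθ)]
    refine measure_congr (Filter.eventuallyEq_univ.2 ?_)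
    filter_upwards [ae_lt_top (measurable_eLipEuc p) hLip] with θ hθ
    obtain ⟨m, hm⟩ := exists_nat_ge (max ‖θ‖ (eLipEuc p θ).toReal)
    refine Set.mem_iUnion.2 ⟨m, by simpa using (le_max_left _ _).trans hm, ?_⟩
    rw [← ENNReal.ofReal_toReal hθ.ne]
    refine ENNReal.ofReal_le_of_le_toReal ?_
    simpa using (le_max_right _ _).trans hm
  rw [← hU]
  exact tendsto_measure_iUnion_atTop hmono

/-- The exponent of `engFactor`, without the factor `β`. -/
noncomputable def energy (p : ℕ) (ψ : C(↥S, ℝ)) {r : ℕ}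
    (θv : Fin r → C((Fin p → ↥S), ℝ)) (σ : Fin r × Fin (p - 1) → ↥S) (t : ↥S) : ℝ :=
  (∑ k : Fin r,
    θv k (fun j : Fin p => if h : (j : ℕ) < p - 1 then σ (k, ⟨(j : ℕ), h⟩) else t)) + ψ t

theorem engFactor_eq (p : ℕ) (β : ℝ) (ψ : C(↥S, ℝ)) {r : ℕ}
    (θv : Fin r → C((Fin p → ↥S), ℝ)) (σ : Fin r × Fin (p - 1) → ↥S) (t : ↥S) :
    engFactor p β ψ θv σ t = Real.exp (β * energy p ψ θv σ t) := rfl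

theorem continuous_engFactor (p : ℕ) (β : ℝ) (ψ : C(↥S, ℝ)) {r : ℕ}
    (θv : Fin r → C((Fin p → ↥S), ℝ)) :
    Continuous (Function.uncurry (engFactor p β ψ θv)) := by
  refine Real.continuous_exp.comp (continuous_const.mul (Continuous.add ?_ (by fun_prop)))
  refine continuous_finsetSum _ fun k _ => (θv k).continuous.comp (continuous_pi fun j => ?_)
  split_ifs <;> fun_prop

section Energy

variable {p : ℕ} {ψ : C(↥S, ℝ)} [CompactSpace ↥S] {r : ℕ}
  {θv : Fin r → C((Fin p → ↥S), ℝ)} {M : ℝ≥0}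

theorem abs_energy_le (hθ : ∀ k, ‖θv k‖ ≤ M) (σ : Fin r × Fin (p - 1) → ↥S) (t : ↥S) :
    |energy p ψ θv σ t| ≤ r * M + ‖ψ‖ := by
  refine (abs_add_le _ _).trans (add_le_add ?_ (ψ.norm_coe_le_norm t))
  refine (Finset.abs_sum_le_sum_abs _ _).trans ?_
  refine (Finset.sum_le_sum fun k _ => ((θv k).norm_coe_le_norm _).trans (hθ k)).trans ?_
  simp

theorem energy_sub_le (hp : 2 ≤ p) {Lψ : ℝ≥0} (hψ : LipschitzWith Lψ ψ)
    (hθ : ∀ k, eLipEuc p (θv k) ≤ M) (σ : Fin r × Fin (p - 1) → ↥S) (s t : ↥S) :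
    energy p ψ θv σ s - energy p ψ θv σ t ≤ (r * M + Lψ) * dist s t := by
  have hsum : ∀ k : Fin r,
      θv k (fun j : Fin p => if h : (j : ℕ) < p - 1 then σ (k, ⟨(j : ℕ), h⟩) else s) -
        θv k (fun j : Fin p => if h : (j : ℕ) < p - 1 then σ (k, ⟨(j : ℕ), h⟩) else t)
        ≤ M * dist s t := by
    intro k
    refine (le_abs_self _).trans ((abs_sub_le_of_eLipEuc_le (hθ k) _ _).trans_eq ?_)
    congr 1
    rw [Finset.sum_eq_single (⟨p - 1, by omega⟩ : Fin p)]
    · simp [Real.sqrt_sq_eq_abs, Subtype.dist_eq, Real.dist_eq]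
    · intro j _ hj
      have hj' : (j : ℕ) < p - 1 := by
        have := j.2
        have : (j : ℕ) ≠ p - 1 := fun h => hj (Fin.ext h)
        omega
      simp [hj']
    · simp
  have h1 := Finset.sum_le_sum fun k (_ : k ∈ Finset.univ) => hsum k
  rw [Finset.sum_sub_distrib] at h1
  have h2 : ψ s - ψ t ≤ Lψ * dist s t :=
    (le_abs_self _).trans (by simpa [Real.dist_eq] using hψ.dist_le_mul s t)
  simp only [Finset.sum_const, Finset.card_univ, Fintype.card_fin, nsmul_eq_mul] at h1
  unfold energy
  linarith

end Energy

theorem integral_mul_weight_mono {Y : Type*} [TopologicalSpace Y] [CompactSpace Y]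
    [MeasurableSpace Y] [OpensMeasurableSpace Y] {ν : Measure Y} [IsFiniteMeasure ν]
    {g h W : Y → ℝ} (hg : Continuous g) (hh : Continuous h) (hW : Continuous W)
    (hW0 : ∀ y, 0 ≤ W y) (hgh : ∀ y, g y ≤ h y) :
    ∫ y, g y * W y ∂ν ≤ ∫ y, h y * W y ∂ν :=
  integral_mono
    ((hg.mul hW).integrable_of_hasCompactSupport (HasCompactSupport.of_compactSpace _))
    ((hh.mul hW).integrable_of_hasCompactSupport (HasCompactSupport.of_compactSpace _))
    fun y => mul_le_mul_of_nonneg_right (hgh y) (hW0 y)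

theorem continuous_integral_of_compactSpace {X Y : Type*} [TopologicalSpace X] [CompactSpace X]
    [MeasurableSpace X] [OpensMeasurableSpace X] [TopologicalSpace Y] [FirstCountableTopology Y]
    [LocallyCompactSpace Y] {μ : Measure X} [IsFiniteMeasure μ]
    {E : Y → X → ℝ} (hE : Continuous (Function.uncurry E)) :
    Continuous fun y => ∫ x, E y x ∂μ := by
  simpa using continuous_parametric_integral_of_continuous (μ := μ) hE isCompact_univ

section OpVal

variable {p : ℕ} {β : ℝ} {ψ : C(↥S, ℝ)} [CompactSpace ↥S] {r : ℕ}
  {θv : Fin r → C((Fin p → ↥S), ℝ)} {M : ℝ≥0}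

theorem weighted_integral_mem_Icc {μ : Measure ↥S} [IsProbabilityMeasure μ]
    (Xv : Fin r × Fin (p - 1) → C(↥S, ℝ)) {g : (Fin r × Fin (p - 1) → ↥S) → ℝ}
    (hg : Continuous g) {a b : ℝ} (hga : ∀ σ, a ≤ g σ) (hgb : ∀ σ, g σ ≤ b) :
    ∫ σ, g σ * ∏ i, Real.exp (β * Xv i (σ i)) ∂(Measure.pi fun _ => μ) ∈
      Set.Icc (a * ∫ σ, ∏ i, Real.exp (β * Xv i (σ i)) ∂(Measure.pi fun _ => μ))
        (b * ∫ σ, ∏ i, Real.exp (β * Xv i (σ i)) ∂(Measure.pi fun _ => μ)) := by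
  have hW : Continuous fun σ : Fin r × Fin (p - 1) → ↥S => ∏ i, Real.exp (β * Xv i (σ i)) := by
    fun_prop
  rw [← integral_const_mul, ← integral_const_mul]
  exact ⟨integral_mul_weight_mono continuous_const hg hW (fun σ => by positivity) hga,
    integral_mul_weight_mono hg continuous_const hW (fun σ => by positivity) hgb⟩

theorem weight_integral_pos (μ : Measure ↥S) [IsProbabilityMeasure μ]
    (Xv : Fin r × Fin (p - 1) → C(↥S, ℝ)) :
    0 < ∫ σ, ∏ i, Real.exp (β * Xv i (σ i)) ∂(Measure.pi fun _ => μ) := by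
  have hW : Continuous fun σ : Fin r × Fin (p - 1) → ↥S => ∏ i, Real.exp (β * Xv i (σ i)) := by
    fun_prop
  rw [integral_pos_iff_support_of_nonneg (fun σ => by positivity)
    (hW.integrable_of_hasCompactSupport (HasCompactSupport.of_compactSpace _))]
  have : Function.support (fun σ : Fin r × Fin (p - 1) → ↥S =>
      ∏ i, Real.exp (β * Xv i (σ i))) = Set.univ :=
    Set.eq_univ_of_forall fun σ => (Finset.prod_pos fun i _ => Real.exp_pos _).ne'
  simp [this]

theorem engFactor_mem_Icc (hβ : 0 < β) (hθ : ∀ k, ‖θv k‖ ≤ M)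
    (σ : Fin r × Fin (p - 1) → ↥S) (t : ↥S) :
    engFactor p β ψ θv σ t ∈
      Set.Icc (Real.exp (-(β * (r * M + ‖ψ‖)))) (Real.exp (β * (r * M + ‖ψ‖))) := by
  have h := abs_le.1 (abs_energy_le (ψ := ψ) hθ σ t)
  rw [engFactor_eq]
  constructor <;> refine Real.exp_le_exp.2 ?_ <;> nlinarith

theorem numerator_mem_Icc (hβ : 0 < β) (hθ : ∀ k, ‖θv k‖ ≤ M)
    (μ : Measure ↥S) [IsProbabilityMeasure μ] (Xv : Fin r × Fin (p - 1) → C(↥S, ℝ)) (t : ↥S) :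
    ∫ σ, engFactor p β ψ θv σ t * ∏ i, Real.exp (β * Xv i (σ i)) ∂(Measure.pi fun _ => μ) ∈
      Set.Icc (Real.exp (-(β * (r * M + ‖ψ‖))) *
          ∫ σ, ∏ i, Real.exp (β * Xv i (σ i)) ∂(Measure.pi fun _ => μ))
        (Real.exp (β * (r * M + ‖ψ‖)) *
          ∫ σ, ∏ i, Real.exp (β * Xv i (σ i)) ∂(Measure.pi fun _ => μ)) :=
  weighted_integral_mem_Icc Xv ((continuous_engFactor p β ψ θv).comp (Continuous.prodMk_left t))
    (fun σ => (engFactor_mem_Icc hβ hθ σ t).1) fun σ => (engFactor_mem_Icc hβ hθ σ t).2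

theorem denominator_mem_Icc (hβ : 0 < β) (hθ : ∀ k, ‖θv k‖ ≤ M)
    (μ : Measure ↥S) [IsProbabilityMeasure μ] (Xv : Fin r × Fin (p - 1) → C(↥S, ℝ)) :
    ∫ σ, (∫ s, engFactor p β ψ θv σ s ∂μ) * ∏ i, Real.exp (β * Xv i (σ i))
        ∂(Measure.pi fun _ => μ) ∈
      Set.Icc (Real.exp (-(β * (r * M + ‖ψ‖))) *
          ∫ σ, ∏ i, Real.exp (β * Xv i (σ i)) ∂(Measure.pi fun _ => μ))
        (Real.exp (β * (r * M + ‖ψ‖)) *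
          ∫ σ, ∏ i, Real.exp (β * Xv i (σ i)) ∂(Measure.pi fun _ => μ)) := by
  have hint : ∀ σ, Integrable (engFactor p β ψ θv σ) μ := fun σ =>
    ((continuous_engFactor p β ψ θv).comp
      (Continuous.prodMk_right σ)).integrable_of_hasCompactSupport
        (HasCompactSupport.of_compactSpace _)
  refine weighted_integral_mem_Icc Xv
    (continuous_integral_of_compactSpace (continuous_engFactor p β ψ θv)) (fun σ => ?_) fun σ => ?_
  · simpa using integral_mono (integrable_const _) (hint σ)
      fun s => (engFactor_mem_Icc (ψ := ψ) hβ hθ σ s).1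
  · simpa using integral_mono (hint σ) (integrable_const _)
      fun s => (engFactor_mem_Icc (ψ := ψ) hβ hθ σ s).2

theorem abs_opVal_le (hβ : 0 < β) (hθ : ∀ k, ‖θv k‖ ≤ M)
    (μ : Measure ↥S) [IsProbabilityMeasure μ] (Xv : Fin r × Fin (p - 1) → C(↥S, ℝ)) (t : ↥S) :
    |opVal p β ψ μ θv Xv t| ≤ 2 * (r * M + ‖ψ‖) := by
  have hN := numerator_mem_Icc (ψ := ψ) hβ hθ μ Xv t
  have hG := denominator_mem_Icc (ψ := ψ) hβ hθ μ Xv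
  have hZ := weight_integral_pos (β := β) μ Xv
  unfold opVal
  set N := ∫ σ, engFactor p β ψ θv σ t * ∏ i, Real.exp (β * Xv i (σ i)) ∂(Measure.pi fun _ => μ)
  set G := ∫ σ, (∫ s, engFactor p β ψ θv σ s ∂μ) * ∏ i, Real.exp (β * Xv i (σ i))
        ∂(Measure.pi fun _ => μ)
  set Z := ∫ σ, ∏ i, Real.exp (β * Xv i (σ i)) ∂(Measure.pi fun _ => μ)
  set D : ℝ := r * M + ‖ψ‖
  have key : ∀ x ∈ Set.Icc (Real.exp (-(β * D)) * Z) (Real.exp (β * D) * Z),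
      0 < x ∧ -(β * D) + Real.log Z ≤ Real.log x ∧ Real.log x ≤ β * D + Real.log Z := by
    intro x hx
    have h0 : 0 < Real.exp (-(β * D)) * Z := by positivity
    have hx0 := h0.trans_le hx.1
    refine ⟨hx0, ?_, ?_⟩
    · simpa [Real.log_mul, hZ.ne'] using Real.log_le_log h0 hx.1
    · simpa [Real.log_mul, hZ.ne'] using Real.log_le_log hx0 hx.2
  obtain ⟨hN0, hN1, hN2⟩ := key N hN
  obtain ⟨hG0, hG1, hG2⟩ := key G hG
  rw [Real.log_div hN0.ne' hG0.ne', abs_mul, abs_of_pos (by positivity : 0 < 1 / β),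
    one_div_mul_eq_div, div_le_iff₀ hβ, abs_le]
  constructor <;> linarith

theorem lipschitzWith_opVal (hp : 2 ≤ p) (hβ : 0 < β) {Lψ : ℝ≥0} (hψ : LipschitzWith Lψ ψ)
    (hθ : ∀ k, ‖θv k‖ ≤ M) (hθL : ∀ k, eLipEuc p (θv k) ≤ M)
    (μ : Measure ↥S) [IsProbabilityMeasure μ] (Xv : Fin r × Fin (p - 1) → C(↥S, ℝ)) :
    LipschitzWith (r * M + Lψ) (opVal p β ψ μ θv Xv) := by
  refine LipschitzWith.of_le_add_mul _ fun s t => ?_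
  have hZ := weight_integral_pos (β := β) μ Xv
  have hpos : ∀ t, 0 < ∫ σ, engFactor p β ψ θv σ t * ∏ i, Real.exp (β * Xv i (σ i))
      ∂(Measure.pi fun _ => μ) := fun t =>
    (mul_pos (Real.exp_pos _) hZ).trans_le (numerator_mem_Icc (ψ := ψ) hβ hθ μ Xv t).1
  have hG : 0 < ∫ σ, (∫ s, engFactor p β ψ θv σ s ∂μ) * ∏ i, Real.exp (β * Xv i (σ i))
      ∂(Measure.pi fun _ => μ) :=
    (mul_pos (Real.exp_pos _) hZ).trans_le (denominator_mem_Icc (ψ := ψ) hβ hθ μ Xv).1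
  have hcont : ∀ t, Continuous fun σ => engFactor p β ψ θv σ t := fun t =>
    (continuous_engFactor p β ψ θv).comp (Continuous.prodMk_left t)
  have hle : ∫ σ, engFactor p β ψ θv σ s * ∏ i, Real.exp (β * Xv i (σ i))
        ∂(Measure.pi fun _ => μ) ≤ Real.exp (β * ((r * M + Lψ) * dist s t)) *
      ∫ σ, engFactor p β ψ θv σ t * ∏ i, Real.exp (β * Xv i (σ i)) ∂(Measure.pi fun _ => μ) := by
    rw [← integral_const_mul]
    simp_rw [← mul_assoc (Real.exp (β * ((r * M + Lψ) * dist s t)))]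
    refine integral_mul_weight_mono (hcont s) (continuous_const.mul (hcont t)) (by fun_prop)
      (fun σ => by positivity) fun σ => ?_
    rw [engFactor_eq, engFactor_eq, ← Real.exp_add, ← mul_add]
    have := energy_sub_le hp hψ hθL σ s t
    exact Real.exp_le_exp.2 (mul_le_mul_of_nonneg_left (by linarith) hβ.le)
  have hlog := Real.log_le_log (hpos s) hle
  rw [Real.log_mul (Real.exp_pos _).ne' (hpos t).ne', Real.log_exp] at hlog
  unfold opVal
  rw [Real.log_div (hpos s).ne' hG.ne', Real.log_div (hpos t).ne' hG.ne', one_div_mul_eq_div,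
    one_div_mul_eq_div, div_add' _ _ _ hβ.ne', div_le_div_iff_of_pos_right hβ]
  push_cast
  linarith

end OpVal

theorem measurableSet_norm_le_and_lipschitzWith [CompactSpace ↥S]
    [MeasurableSpace C(↥S, ℝ)] [BorelSpace C(↥S, ℝ)] (C : ℝ) (L : ℝ≥0) :
    MeasurableSet {f : C(↥S, ℝ) | ‖f‖ ≤ C ∧ LipschitzWith L f} := by
  have h : {f : C(↥S, ℝ) | LipschitzWith L f} =
      ⋂ (x) (y), {f : C(↥S, ℝ) | dist (f x) (f y) ≤ L * dist x y} := by
    ext f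
    simp [lipschitzWith_iff_dist_le_mul]
  have hclosed : IsClosed {f : C(↥S, ℝ) | LipschitzWith L f} := by
    rw [h]
    exact isClosed_iInter fun x => isClosed_iInter fun y =>
      isClosed_le ((continuous_eval_const x).dist (continuous_eval_const y)) continuous_const
  exact ((isClosed_le continuous_norm continuous_const).inter hclosed).measurableSet

theorem tendsto_sum_range_measure_singleton (P : Measure ℕ) [IsProbabilityMeasure P] :
    Filter.Tendsto (fun n : ℕ => ∑ r ∈ Finset.range n, P {r}) Filter.atTop (nhds 1) := by
  have h : ∑' r : ℕ, P {r} = 1 := by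
    rw [← measure_univ (μ := P), ← Measure.tsum_indicator_apply_singleton P _ MeasurableSet.univ]
    simp
  rw [← h]
  exact ENNReal.summable.hasSum.tendsto_sum_nat

/-- On bounded interactions the random cavity function lies in a fixed compact set. -/
theorem opVal_mem_image {p : ℕ} (hp : 2 ≤ p) {β : ℝ} (hβ : 0 < β) [CompactSpace ↥S]
    {ψ : C(↥S, ℝ)} {Lψ : ℝ≥0} (hψ : LipschitzWith Lψ ψ) {r n : ℕ} (hrn : r ≤ n) {M : ℝ≥0}
    {θv : Fin r → C((Fin p → ↥S), ℝ)} (hθ : ∀ k, θv k ∈ boundedInteractions S p M)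
    (μ : Measure ↥S) [IsProbabilityMeasure μ] (Xv : Fin r × Fin (p - 1) → C(↥S, ℝ))
    {C : ℝ} {L : ℝ≥0} (hC : 2 * (n * M + ‖ψ‖) ≤ C) (hL : n * M + Lψ ≤ L) :
    (fun t => opVal p β ψ μ θv Xv t) ∈
      (DFunLike.coe '' {f : C(↥S, ℝ) | ‖f‖ ≤ C ∧ LipschitzWith L f}) := by
  have hlip := lipschitzWith_opVal hp hβ hψ (fun k => (hθ k).1) (fun k => (hθ k).2) μ Xv
  have hrn' : (r : ℝ) * M ≤ n * M := by gcongr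
  refine ⟨⟨opVal p β ψ μ θv Xv, hlip.continuous⟩, ⟨?_, hlip.weaken (le_trans (by gcongr) hL)⟩, rfl⟩
  refine (ContinuousMap.norm_le _ (le_trans (by positivity) hC)).2 fun t => ?_
  exact (abs_opVal_le (ψ := ψ) hβ (fun k => (hθ k).1) μ Xv t).trans (by linarith)

/-- Tightness: for fixed `0 < β < ∞`, the family
`{T_{μ,β}(λ) : μ ∈ Pr(Σ), λ ∈ Pr₁}` is tight: for every `ε > 0` there are `C, L > 0` such
that every `T_{μ,β}(λ)` gives mass at least `1 - ε` to
`K(C,L) = {f : ‖f‖∞ ≤ C, Lip(f) ≤ L}`. -/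
theorem cavity_operator_tight
    (p : ℕ) (hp : 2 ≤ p) (α : ℝ≥0) (hα : 0 < α) (R : ℝ) (hR : 0 < R)
    [CompactSpace ↥S] [Nonempty ↥S] (hSR : S ⊆ Set.Icc (-R) R)
    (ψ : C(↥S, ℝ)) (Lψ : ℝ≥0) (hψLip : LipschitzWith Lψ ψ)
    [MeasurableSpace C((Fin p → ↥S), ℝ)] [BorelSpace C((Fin p → ↥S), ℝ)]
    [MeasurableSpace C(↥S, ℝ)] [BorelSpace C(↥S, ℝ)]
    (μθ : Measure C((Fin p → ↥S), ℝ)) [IsProbabilityMeasure μθ]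
    (hmom2 : Integrable (fun θ : C((Fin p → ↥S), ℝ) => ‖θ‖ ^ 2) μθ)
    (hmomLip : ∫⁻ θ, eLipEuc p θ ∂μθ ≠ ⊤)
    (β : ℝ) (hβ : 0 < β)
    (T : Measure ↥S → Measure C(↥S, ℝ) → Measure C(↥S, ℝ))
    (hT : ∀ μ : Measure ↥S, IsProbabilityMeasure μ → IsCavityOp p α β ψ μθ μ (T μ)) :
    ∀ ε : ℝ, 0 < ε → ∃ C L : ℝ, 0 < C ∧ 0 < L ∧
      ∀ (μ : Measure ↥S) (lam : Measure C(↥S, ℝ)),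
        IsProbabilityMeasure μ → MemPr1 lam →
          ENNReal.ofReal (1 - ε)
            ≤ T μ lam {f : C(↥S, ℝ) | ‖f‖ ≤ C ∧ LipschitzWith (Real.toNNReal L) f} := by
  intro ε hε
  have hlt : ENNReal.ofReal (1 - ε) < 1 := by
    rw [ENNReal.ofReal_lt_one]
    linarith
  obtain ⟨n, hn⟩ := ((tendsto_sum_range_measure_singleton
    (ProbabilityTheory.poissonMeasure (α * p))).eventually (lt_mem_nhds hlt)).exists
  set P := ∑ r ∈ Finset.range n, (ProbabilityTheory.poissonMeasure (α * p)) {r} with hP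
  have hlim : Filter.Tendsto (fun M : ℕ => P * μθ (boundedInteractions S p M) ^ n)
      Filter.atTop (nhds P) := by
    have h := ENNReal.Tendsto.const_mul (a := P)
      (((ENNReal.continuous_pow n).tendsto 1).comp
        (tendsto_measure_boundedInteractions p μθ hmomLip)) (Or.inl (by simp))
    simpa using h
  obtain ⟨M, hM⟩ := (hlim.eventually (lt_mem_nhds hn)).exists
  refine ⟨2 * (n * M + ‖ψ‖) + 1, n * M + Lψ + 1, by positivity, by positivity, ?_⟩
  intro μ lam hμ hlam
  have := hlam.1
  rw [hT μ hμ lam hlam _ (measurableSet_norm_le_and_lipschitzWith _ _)]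
  refine hM.le.trans (le_trans ?_ (ENNReal.sum_le_tsum (Finset.range n)))
  rw [hP, Finset.sum_mul]
  refine Finset.sum_le_sum fun r hr => mul_le_mul_right ?_ _
  have hrn := (Finset.mem_range.1 hr).le
  calc μθ (boundedInteractions S p M) ^ n ≤ μθ (boundedInteractions S p M) ^ r :=
        pow_le_pow_right_of_le_one' prob_le_one hrn
    _ = ((Measure.pi fun _ : Fin r => μθ).prod (Measure.pi fun _ : Fin r × Fin (p - 1) => lam))
          ((Set.univ.pi fun _ => boundedInteractions S p M) ×ˢ Set.univ) := by
        rw [Measure.prod_prod, Measure.pi_pi]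
        simp
    _ ≤ _ := by
        refine measure_mono fun q hq => ?_
        refine opVal_mem_image hp hβ hψLip hrn (M := M) (fun k => hq.1 k (Set.mem_univ k)) μ q.2
          (by simp) ?_
        rw [← NNReal.coe_le_coe, Real.coe_toNNReal _ (by positivity)]
        push_cast
        linarith

end DilutedSpinGlass
end

section
/- Assume that for every integer k ≥ 1 there exists a measurable function C_k : [0,1] → ℝ such that for Lebesgue-almost every (w,u₁,u₂) ∈ [0,1]³ one has ∫₀¹ σ̄^{(k)}(w,u₁,v)·σ̄^{(k)}(w,u₂,v) dv = C_k(w). Then for every continuous function g : Σ → ℝ, for Lebesgue-almost every (w,u,v) ∈ [0,1]³, ∫₀¹ g(σ(w,u,v,x)) dx = ∫₀¹∫₀¹ g(σ(w,u',v,x)) dx du'. -/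
open MeasureTheory

/-- A bounded kernel whose rows have almost everywhere constant mutual overlap has rows that
integrate, over every measurable set, to the measure of the set times the mean row. -/
lemma ae_setIntegral_eq_of_overlap_const {α β : Type*} [MeasurableSpace α] [MeasurableSpace β]
    (μ : Measure α) (ν : Measure β) [IsProbabilityMeasure μ] [IsProbabilityMeasure ν]
    {f : α × β → ℝ} (hf : Measurable f) {M c : ℝ} (hM : ∀ q, |f q| ≤ M)
    (hc : ∀ᵐ p ∂μ.prod μ, ∫ v, f (p.1, v) * f (p.2, v) ∂ν = c)
    {A : Set α} (hA : MeasurableSet A) :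
    ∀ᵐ v ∂ν, ∫ u in A, f (u, v) ∂μ = μ.real A * ∫ u, f (u, v) ∂μ := by
  set h : α → ℝ := fun u => A.indicator 1 u - μ.real A with hh
  have hhm : Measurable h := (measurable_one.indicator hA).sub_const _
  have hhb : ∀ u, |h u| ≤ 1 := fun u => by
    have h1 : μ.real A ≤ 1 := measureReal_le_one
    have h2 : 0 ≤ μ.real A := measureReal_nonneg
    rw [abs_le]
    by_cases hu : u ∈ A <;> simp only [hh, hu, Set.indicator_of_mem, Set.indicator_of_notMem,
      not_false_eq_true, Pi.one_apply] <;> constructor <;> linarith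
  have hh0 : ∫ u, h u ∂μ = 0 := by
    have h1 : Integrable (A.indicator (1 : α → ℝ)) μ := (integrable_const (1 : ℝ)).indicator hA
    simp only [hh]
    rw [integral_sub h1 (integrable_const _)]
    simp [integral_indicator_one hA]
  have hfv : ∀ v, Integrable (fun u => f (u, v)) μ := fun v =>
    Integrable.of_bound (hf.comp measurable_prodMk_right).aestronglyMeasurable M (.of_forall fun u => hM _)
  set G : β → ℝ := fun v => ∫ u, h u * f (u, v) ∂μ with hG
  have hGeq : ∀ v, G v = ∫ u in A, f (u, v) ∂μ - μ.real A * ∫ u, f (u, v) ∂μ := fun v => by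
    rw [← integral_indicator hA, ← integral_const_mul,
      ← integral_sub ((hfv v).indicator hA) ((hfv v).const_mul _)]
    refine integral_congr_ae (.of_forall fun u => ?_)
    by_cases hu : u ∈ A <;> simp [hh, hu, sub_mul]
  have hGm : StronglyMeasurable G := by
    have : Measurable fun q : β × α => h q.2 * f (q.2, q.1) := by fun_prop
    exact this.stronglyMeasurable.integral_prod_right
  have hbound : ∀ u v, |h u * f (u, v)| ≤ M := fun u v => by
    rw [abs_mul]
    nlinarith [hhb u, hM (u, v), abs_nonneg (h u), abs_nonneg (f (u, v))]
  have hGb : ∀ v, |G v| ≤ M := fun v => by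
    simpa using norm_integral_le_of_norm_le_const (μ := μ) (f := fun u => h u * f (u, v))
      (.of_forall fun u => hbound u v)
  have hsq : ∫ v, G v * G v ∂ν = 0 := by
    have e1 : ∀ v, G v * G v =
        ∫ p : α × α, (h p.1 * f (p.1, v)) * (h p.2 * f (p.2, v)) ∂μ.prod μ := fun v =>
      (integral_prod_mul (fun u => h u * f (u, v)) (fun u => h u * f (u, v))).symm
    simp_rw [e1]
    rw [integral_integral_swap]
    · have e2 : ∀ᵐ p ∂μ.prod μ, ∫ v, (h p.1 * f (p.1, v)) * (h p.2 * f (p.2, v)) ∂ν =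
          (h p.1 * h p.2) * c := by
        filter_upwards [hc] with p hp
        rw [← hp, ← integral_const_mul]
        congr 1; ext v; ring
      rw [integral_congr_ae e2, integral_mul_const, integral_prod_mul, hh0]
      simp
    · refine Integrable.of_bound (C := M * M) (by
        apply Measurable.aestronglyMeasurable
        simp only [Function.uncurry_def]
        fun_prop) (.of_forall fun q => ?_)
      simp only [Function.uncurry_def, norm_mul]
      have := hbound q.2.1 q.1
      have := hbound q.2.2 q.1
      rw [← norm_mul, ← norm_mul]
      exact mul_le_mul (hbound _ _) (hbound _ _) (norm_nonneg _) ((abs_nonneg _).trans this)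
  have hGi : Integrable (fun v => G v * G v) ν :=
    Integrable.of_bound (hGm.mul hGm).aestronglyMeasurable (M * M) (.of_forall fun v => by
      rw [norm_mul]
      exact mul_le_mul (hGb v) (hGb v) (norm_nonneg _) ((abs_nonneg _).trans (hGb v)))
  rw [integral_eq_zero_iff_of_nonneg (fun v => mul_self_nonneg _) hGi] at hsq
  filter_upwards [hsq] with v hv
  have := hGeq v
  rw [mul_self_eq_zero.mp hv] at this
  linarith

/-- An integrable function on a product space whose integral over every measurable rectangle
vanishes is almost everywhere zero. -/
lemma ae_eq_zero_of_forall_setIntegral_prod_eq_zero {α β : Type*} [MeasurableSpace α]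
    [MeasurableSpace β] {μ : Measure α} {ν : Measure β} [SFinite μ] [SFinite ν]
    {f : α × β → ℝ} (hf : Integrable f (μ.prod ν))
    (h : ∀ A B, MeasurableSet A → MeasurableSet B → ∫ q in A ×ˢ B, f q ∂μ.prod ν = 0) :
    f =ᵐ[μ.prod ν] 0 := by
  have key : ∀ D, MeasurableSet D → ∫ q in D, f q ∂μ.prod ν = 0 := by
    intro D hD
    induction D, hD using MeasurableSpace.induction_on_inter generateFrom_prod.symm
      isPiSystem_prod with
    | empty => simp
    | basic t ht =>
      obtain ⟨A, hA, B, hB, rfl⟩ := ht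
      exact h A B hA hB
    | compl t ht ih =>
      have huniv := h Set.univ Set.univ .univ .univ
      rw [Set.univ_prod_univ, setIntegral_univ] at huniv
      rw [setIntegral_compl ht hf, ih, huniv, sub_zero]
    | iUnion t hd ht ih =>
      rw [integral_iUnion ht hd hf.integrableOn]
      simp [ih]
  exact hf.ae_eq_zero_of_forall_setIntegral_eq_zero fun s hs _ => key s hs

/-- A bounded kernel whose rows have almost everywhere constant mutual overlap has almost all of
its rows equal to the mean row. -/
lemma ae_eq_integral_of_overlap_const {α β : Type*} [MeasurableSpace α] [MeasurableSpace β]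
    (μ : Measure α) (ν : Measure β) [IsProbabilityMeasure μ] [IsProbabilityMeasure ν]
    {f : α × β → ℝ} (hf : Measurable f) {M c : ℝ} (hM : ∀ q, |f q| ≤ M)
    (hc : ∀ᵐ p ∂μ.prod μ, ∫ v, f (p.1, v) * f (p.2, v) ∂ν = c) :
    ∀ᵐ q ∂μ.prod ν, f q = ∫ u, f (u, q.2) ∂μ := by
  have hFm : StronglyMeasurable fun v => ∫ u, f (u, v) ∂μ :=
    hf.stronglyMeasurable.integral_prod_left'
  have hFb : ∀ v, |∫ u, f (u, v) ∂μ| ≤ M := fun v => by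
    simpa using norm_integral_le_of_norm_le_const (μ := μ) (f := fun u => f (u, v))
      (.of_forall fun u => hM (u, v))
  have hfi : Integrable f (μ.prod ν) :=
    Integrable.of_bound hf.aestronglyMeasurable M (.of_forall hM)
  have hFi : Integrable (fun q : α × β => ∫ u, f (u, q.2) ∂μ) (μ.prod ν) :=
    Integrable.of_bound (hFm.comp_measurable measurable_snd).aestronglyMeasurable M
      (.of_forall fun q => hFb q.2)
  have h0 := ae_eq_zero_of_forall_setIntegral_prod_eq_zero (hfi.sub hFi) fun A B hA hB => by
    simp only [Pi.sub_apply]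
    rw [integral_sub hfi.integrableOn hFi.integrableOn, sub_eq_zero, ← Measure.prod_restrict]
    have hfi' : Integrable f ((μ.restrict A).prod (ν.restrict B)) := by
      rw [Measure.prod_restrict]; exact hfi.integrableOn
    have hFi' : Integrable (fun q : α × β => ∫ u, f (u, q.2) ∂μ)
        ((μ.restrict A).prod (ν.restrict B)) := by
      rw [Measure.prod_restrict]; exact hFi.integrableOn
    rw [integral_prod_symm _ hfi', integral_prod_symm _ hFi']
    refine integral_congr_ae ?_
    filter_upwards [ae_restrict_of_ae (ae_setIntegral_eq_of_overlap_const μ ν hf hM hc hA)]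
      with v hv
    simp [hv]
  filter_upwards [h0] with q hq
  exact sub_eq_zero.mp hq

/-- A continuous function of a bounded random variable is integrable. -/
lemma integrable_continuous_comp {Ω : Type*} [MeasurableSpace Ω] (μ : Measure Ω)
    [IsFiniteMeasure μ] {X : Ω → ℝ} (hX : Measurable X) {a b : ℝ}
    (hXab : ∀ ω, X ω ∈ Set.Icc a b) {g : ℝ → ℝ} (hg : Continuous g) :
    Integrable (fun ω => g (X ω)) μ := by
  obtain ⟨C, hC⟩ := isCompact_Icc.exists_bound_of_continuousOn (hg.continuousOn (s := Set.Icc a b))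
  exact Integrable.of_bound (hg.measurable.comp hX).aestronglyMeasurable C
    (.of_forall fun ω => hC _ (hXab ω))

/-- Two random variables with values in a compact interval and with the same moments have the same
expectation under every continuous function. -/
lemma integral_comp_eq_of_moments_eq {Ω Ω' : Type*} [MeasurableSpace Ω] [MeasurableSpace Ω']
    (μ : Measure Ω) (ν : Measure Ω') [IsProbabilityMeasure μ] [IsProbabilityMeasure ν]
    {X : Ω → ℝ} {Y : Ω' → ℝ} (hX : Measurable X) (hY : Measurable Y) {a b : ℝ}
    (hXab : ∀ ω, X ω ∈ Set.Icc a b) (hYab : ∀ ω, Y ω ∈ Set.Icc a b)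
    (hmom : ∀ k : ℕ, ∫ ω, X ω ^ k ∂μ = ∫ ω, Y ω ^ k ∂ν)
    {g : ℝ → ℝ} (hg : Continuous g) :
    ∫ ω, g (X ω) ∂μ = ∫ ω, g (Y ω) ∂ν := by
  have hpoly : ∀ p : Polynomial ℝ, ∫ ω, p.eval (X ω) ∂μ = ∫ ω, p.eval (Y ω) ∂ν := by
    intro p
    simp_rw [Polynomial.eval_eq_sum_range]
    rw [integral_finsetSum _ fun i _ => ((integrable_continuous_comp μ hX hXab
        (continuous_pow i)).const_mul _),
      integral_finsetSum _ fun i _ => ((integrable_continuous_comp ν hY hYab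
        (continuous_pow i)).const_mul _)]
    simp_rw [integral_const_mul, hmom]
  have happrox : ∀ {p : Polynomial ℝ} {ε : ℝ}, (∀ x ∈ Set.Icc a b, |p.eval x - g x| < ε) →
      |∫ ω, p.eval (X ω) ∂μ - ∫ ω, g (X ω) ∂μ| ≤ ε ∧
      |∫ ω, p.eval (Y ω) ∂ν - ∫ ω, g (Y ω) ∂ν| ≤ ε := by
    intro p ε hp
    rw [← integral_sub (integrable_continuous_comp μ hX hXab p.continuous)
        (integrable_continuous_comp μ hX hXab hg),
      ← integral_sub (integrable_continuous_comp ν hY hYab p.continuous)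
        (integrable_continuous_comp ν hY hYab hg)]
    constructor
    · simpa using norm_integral_le_of_norm_le_const (μ := μ)
        (f := fun ω => p.eval (X ω) - g (X ω)) (.of_forall fun ω => (hp _ (hXab ω)).le)
    · simpa using norm_integral_le_of_norm_le_const (μ := ν)
        (f := fun ω => p.eval (Y ω) - g (Y ω)) (.of_forall fun ω => (hp _ (hYab ω)).le)
  refine eq_of_forall_dist_le fun ε hε => ?_
  obtain ⟨p, hp⟩ :=
    exists_polynomial_near_of_continuousOn a b g hg.continuousOn (ε / 2) (by linarith)
  obtain ⟨h1, h2⟩ := happrox hp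
  rw [hpoly p] at h1
  rw [Real.dist_eq]
  rw [abs_le] at *
  constructor <;> linarith


/-- Let `σ : [0,1]⁴ → Σ ⊆ [-R,R]` be Borel measurable and suppose that for each
`k ≥ 1` the overlap `∫₀¹ σ̄^{(k)}(w,u₁,v)·σ̄^{(k)}(w,u₂,v) dv` is a.e. a function `C_k(w)` of `w`
alone.  Then for every continuous `g : Σ → ℝ`, for a.e. `(w,u,v) ∈ [0,1]³`,
`∫₀¹ g(σ(w,u,v,x)) dx = ∫₀¹∫₀¹ g(σ(w,u',v,x)) dx du'`. -/
theorem pure_state_single_spin (R : ℝ) (hR : 0 < R) (S : Set ℝ) (hS : IsCompact S)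
    (hSR : S ⊆ Set.Icc (-R) R)
    (σ : ℝ × ℝ × ℝ × ℝ → ℝ) (hσmeas : Measurable σ) (hσmem : ∀ q, σ q ∈ S)
    (hoverlap : ∀ k : ℕ, 1 ≤ k → ∃ C : ℝ → ℝ, Measurable C ∧
      (∀ᵐ q : ℝ × ℝ × ℝ ∂((volume.restrict (Set.Icc (0:ℝ) 1)).prod
          ((volume.restrict (Set.Icc (0:ℝ) 1)).prod (volume.restrict (Set.Icc (0:ℝ) 1)))),
        ∫ v in Set.Icc (0:ℝ) 1,
            (∫ x in Set.Icc (0:ℝ) 1, (σ (q.1, q.2.1, v, x)) ^ k) *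
            (∫ x in Set.Icc (0:ℝ) 1, (σ (q.1, q.2.2, v, x)) ^ k)
          = C q.1)) :
    ∀ g : ℝ → ℝ, ContinuousOn g S →
      (∀ᵐ q : ℝ × ℝ × ℝ ∂((volume.restrict (Set.Icc (0:ℝ) 1)).prod
          ((volume.restrict (Set.Icc (0:ℝ) 1)).prod (volume.restrict (Set.Icc (0:ℝ) 1)))),
        ∫ x in Set.Icc (0:ℝ) 1, g (σ (q.1, q.2.1, q.2.2, x))
          = ∫ u' in Set.Icc (0:ℝ) 1, ∫ x in Set.Icc (0:ℝ) 1, g (σ (q.1, u', q.2.2, x))) := by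
  intro g hg
  set μ : Measure ℝ := volume.restrict (Set.Icc (0 : ℝ) 1) with hμ
  have : IsProbabilityMeasure μ := ⟨by simp [hμ]⟩
  have hmem : ∀ q, σ q ∈ Set.Icc (-R) R := fun q => hSR (hσmem q)
  have hmoment : ∀ k : ℕ, ∀ᵐ q : ℝ × ℝ × ℝ ∂μ.prod (μ.prod μ),
      ∫ x, σ (q.1, q.2.1, q.2.2, x) ^ k ∂μ
        = ∫ u', ∫ x, σ (q.1, u', q.2.2, x) ^ k ∂μ ∂μ := by
    intro k
    rcases Nat.eq_zero_or_pos k with rfl | hk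
    · simp
    obtain ⟨C, -, hC⟩ := hoverlap k hk
    have hF : Measurable fun q : ℝ × ℝ × ℝ => ∫ x, σ (q.1, q.2.1, q.2.2, x) ^ k ∂μ := by
      have : Measurable fun p : (ℝ × ℝ × ℝ) × ℝ => σ (p.1.1, p.1.2.1, p.1.2.2, p.2) ^ k := by
        fun_prop
      exact this.stronglyMeasurable.integral_prod_right.measurable
    have hFmean : Measurable fun q : ℝ × ℝ × ℝ =>
        ∫ u', ∫ x, σ (q.1, u', q.2.2, x) ^ k ∂μ ∂μ := by
      have : Measurable fun p : (ℝ × ℝ × ℝ) × ℝ =>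
          ∫ x, σ (p.1.1, p.2, p.1.2.2, x) ^ k ∂μ :=
        hF.comp (g := fun q : ℝ × ℝ × ℝ => ∫ x, σ (q.1, q.2.1, q.2.2, x) ^ k ∂μ)
          (f := fun p : (ℝ × ℝ × ℝ) × ℝ => (p.1.1, p.2, p.1.2.2)) (by fun_prop)
      exact this.stronglyMeasurable.integral_prod_right.measurable
    have hFb : ∀ q : ℝ × ℝ × ℝ, |∫ x, σ (q.1, q.2.1, q.2.2, x) ^ k ∂μ| ≤ R ^ k := fun q => by
      simpa using norm_integral_le_of_norm_le_const (μ := μ)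
        (f := fun x => σ (q.1, q.2.1, q.2.2, x) ^ k) (.of_forall fun x => by
          rw [norm_pow]
          exact pow_le_pow_left₀ (norm_nonneg _) (abs_le.mpr (hmem _)) k)
    rw [Measure.ae_prod_iff_ae_ae (measurableSet_eq_fun hF hFmean)]
    filter_upwards [Measure.ae_ae_of_ae_prod hC] with w hw
    exact ae_eq_integral_of_overlap_const μ μ
      (f := fun p : ℝ × ℝ => ∫ x, σ (w, p.1, p.2, x) ^ k ∂μ)
      (hF.comp measurable_prodMk_left) (fun p => hFb (w, p)) hw
  obtain ⟨G, hG⟩ := ContinuousMap.exists_restrict_eq hS.isClosed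
    ⟨S.domRestrict g, continuousOn_iff_continuous_domRestrict.mp hg⟩
  have hGσ : ∀ q, g (σ q) = G (σ q) := fun q => (DFunLike.congr_fun hG ⟨σ q, hσmem q⟩).symm
  simp_rw [hGσ]
  filter_upwards [ae_all_iff.mpr hmoment] with q hq
  have hX : Measurable fun x => σ (q.1, q.2.1, q.2.2, x) := by fun_prop
  have hY : Measurable fun p : ℝ × ℝ => σ (q.1, p.1, q.2.2, p.2) := by fun_prop
  rw [integral_comp_eq_of_moments_eq μ (μ.prod μ) hX hY (fun _ => hmem _) (fun _ => hmem _)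
    (fun k => ?_) G.continuous]
  · exact integral_prod _ (integrable_continuous_comp _ hY (fun _ => hmem _) G.continuous)
  · rw [hq k]
    exact (integral_prod _ (integrable_continuous_comp _ hY (fun _ => hmem _)
      (continuous_pow k))).symm
end

section
/- Assume that for every continuous function g : Σ → ℝ, for Lebesgue-almost every (w,u,v) ∈ [0,1]³, ∫₀¹ g(σ(w,u,v,x)) dx = ∫₀¹∫₀¹ g(σ(w,u',v,x)) dx du'. Then for every integer n ≥ 1 and every continuous function g : Σⁿ → ℝ, for Lebesgue-almost every (w,v₁,…,vₙ) ∈ [0,1]^{1+n}, ∫_{[0,1]^{1+n}} g(σ(w,u,v₁,x₁),…,σ(w,u,vₙ,xₙ)) du dx₁⋯dxₙ = ∫_{[0,1]^{2n}} g(σ(w,u₁,v₁,x₁),…,σ(w,uₙ,vₙ,xₙ)) du₁⋯duₙ dx₁⋯dxₙ. -/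
open MeasureTheory

open scoped BoundedContinuousFunction NNReal

/-- Countably many bounded continuous functions separate the Borel probability measures on `ℝ`. -/
theorem exists_countable_separating_boundedContinuous :
    ∃ f : ℚ × ℕ → ℝ →ᵇ ℝ≥0, ∀ (μ ν : Measure ℝ) [IsProbabilityMeasure μ] [IsProbabilityMeasure ν],
      (∀ k, ∫ x, (f k x : ℝ) ∂μ = ∫ x, (f k x : ℝ) ∂ν) → μ = ν := by
  refine ⟨fun k => (isClosed_Iic (a := (k.1 : ℝ))).apprSeq k.2, fun μ ν _ _ h => ?_⟩
  refine ext_of_generate_finite _ (BorelSpace.measurable_eq.trans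
    Real.borel_eq_generateFrom_Iic_rat) Real.isPiSystem_Iic_rat (fun s hs => ?_) (by simp)
  simp only [Set.mem_iUnion, Set.mem_singleton_iff] at hs
  obtain ⟨a, rfl⟩ := hs
  have hμ := HasOuterApproxClosed.tendsto_lintegral_apprSeq (isClosed_Iic (a := (a : ℝ))) μ
  have hν := HasOuterApproxClosed.tendsto_lintegral_apprSeq (isClosed_Iic (a := (a : ℝ))) ν
  refine tendsto_nhds_unique hμ (hν.congr fun n => ?_)
  rw [← ENNReal.toReal_eq_toReal_iff'
    (BoundedContinuousFunction.lintegral_lt_top_of_nnreal _ _).ne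
    (BoundedContinuousFunction.lintegral_lt_top_of_nnreal _ _).ne,
    BoundedContinuousFunction.toReal_lintegral_coe_eq_integral,
    BoundedContinuousFunction.toReal_lintegral_coe_eq_integral]
  exact (h (a, n)).symm

/-- If for every bounded continuous `f` the mean of `f (σ (w, u, v, ·))` almost surely does not
depend on `u`, then almost surely the law of `σ (w, u, v, ·)` does not depend on `u`. -/
theorem ae_map_eq_map_of_forall_integral_eq (P : Measure ℝ) [IsProbabilityMeasure P]
    {σ : ℝ × ℝ × ℝ × ℝ → ℝ} (hσ : Measurable σ)
    (h : ∀ f : ℝ →ᵇ ℝ≥0, ∀ᵐ q : ℝ × ℝ × ℝ ∂(P.prod (P.prod P)),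
      ∫ x, (f (σ (q.1, q.2.1, q.2.2, x)) : ℝ) ∂P
        = ∫ u, ∫ x, (f (σ (q.1, u, q.2.2, x)) : ℝ) ∂P ∂P) :
    ∀ᵐ q : ℝ × ℝ × ℝ ∂(P.prod (P.prod P)),
      P.map (fun x => σ (q.1, q.2.1, q.2.2, x))
        = (P.prod P).map (fun p : ℝ × ℝ => σ (q.1, p.1, q.2.2, p.2)) := by
  obtain ⟨f, hf⟩ := exists_countable_separating_boundedContinuous
  filter_upwards [ae_all_iff.2 fun k => h (f k)] with q hq
  have h₁ : Measurable fun x => σ (q.1, q.2.1, q.2.2, x) := by fun_prop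
  have h₂ : Measurable fun p : ℝ × ℝ => σ (q.1, p.1, q.2.2, p.2) := by fun_prop
  have := Measure.isProbabilityMeasure_map (μ := P) h₁.aemeasurable
  have := Measure.isProbabilityMeasure_map (μ := P.prod P) h₂.aemeasurable
  refine hf _ _ fun k => ?_
  have hk : Measurable fun y => (f k y : ℝ) :=
    (NNReal.continuous_coe.comp (f k).continuous).measurable
  rw [integral_map h₁.aemeasurable hk.aestronglyMeasurable,
    integral_map h₂.aemeasurable hk.aestronglyMeasurable, hq k, integral_prod]
  refine Integrable.of_bound (hk.comp h₂).aestronglyMeasurable (nndist (f k) 0)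
    (ae_of_all _ fun p => ?_)
  rw [NNReal.norm_eq, NNReal.coe_le_coe]
  exact BoundedContinuousFunction.NNReal.upper_bound (f k) _

/-- Reordering of quantifiers from `(w, u, v)` to `(w, v)` and then `u`. -/
theorem ae_ae_of_ae_prod_prod (P : Measure ℝ) [IsProbabilityMeasure P] {p : ℝ × ℝ × ℝ → Prop}
    (h : ∀ᵐ q ∂(P.prod (P.prod P)), p q) :
    ∀ᵐ q : ℝ × ℝ ∂(P.prod P), ∀ᵐ u ∂P, p (q.1, u, q.2) :=
  Measure.ae_ae_of_ae_prod <|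
    (((MeasurePreserving.id P).prod Measure.measurePreserving_swap).comp
      (measurePreserving_prodAssoc P P P)).quasiMeasurePreserving.ae h

/-- Integrating a function of independent variables, one for each coordinate, against their
joint law. -/
theorem integral_pi_comp_eq_integral_pi_map {n : ℕ} (P : Measure ℝ) [IsProbabilityMeasure P]
    {S : Set ℝ} (hS : IsClosed S) {g : (Fin n → ℝ) → ℝ}
    (hg : ContinuousOn g {y | ∀ i, y i ∈ S}) {f : Fin n → ℝ → ℝ} (hf : ∀ i, Measurable (f i))
    (hfS : ∀ i x, f i x ∈ S) :
    ∫ x : Fin n → ℝ, g (fun i => f i (x i)) ∂(Measure.pi fun _ => P)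
      = ∫ y, Set.indicator {y | ∀ i, y i ∈ S} g y ∂(Measure.pi fun i => P.map (f i)) := by
  have hT : MeasurableSet {y : Fin n → ℝ | ∀ i, y i ∈ S} := by
    simp only [Set.ofPred_forall]
    exact .iInter fun i => measurable_pi_apply i hS.measurableSet
  have hind : Measurable (Set.indicator {y : Fin n → ℝ | ∀ i, y i ∈ S} g) := by
    classical
    rw [← Set.piecewise_eq_indicator]
    exact hg.measurable_piecewise continuousOn_const hT
  have (i : Fin n) := Measure.isProbabilityMeasure_map (μ := P) (hf i).aemeasurable
  rw [← Measure.pi_map_pi fun i => (hf i).aemeasurable,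
    integral_map (Measurable.aemeasurable (by fun_prop)) hind.aestronglyMeasurable]
  refine integral_congr_ae (ae_of_all _ fun x => ?_)
  exact (Set.indicator_of_mem (s := {y : Fin n → ℝ | ∀ i, y i ∈ S}) (fun i => hfS i _) g).symm

/-- Let `σ : [0,1]⁴ → Σ ⊆ [-R,R]` be Borel measurable.  Assume that for every
continuous `g : Σ → ℝ`, for a.e. `(w,u,v) ∈ [0,1]³`,
`∫₀¹ g(σ(w,u,v,x)) dx = ∫₀¹∫₀¹ g(σ(w,u',v,x)) dx du'`.  Then for every `n ≥ 1` and every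
continuous `g : Σⁿ → ℝ`, for a.e. `(w,v₁,…,vₙ) ∈ [0,1]^{1+n}`,
`∫_{[0,1]^{1+n}} g(σ(w,u,v₁,x₁),…,σ(w,u,vₙ,xₙ)) du dx
  = ∫_{[0,1]^{2n}} g(σ(w,u₁,v₁,x₁),…,σ(w,uₙ,vₙ,xₙ)) du dx`. -/
theorem pure_state_many_spins (R : ℝ) (hR : 0 < R) (S : Set ℝ) (hS : IsCompact S)
    (hSR : S ⊆ Set.Icc (-R) R)
    (σ : ℝ × ℝ × ℝ × ℝ → ℝ) (hσmeas : Measurable σ) (hσmem : ∀ q, σ q ∈ S)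
    (hsingle : ∀ g : ℝ → ℝ, ContinuousOn g S →
      (∀ᵐ q : ℝ × ℝ × ℝ ∂((volume.restrict (Set.Icc (0:ℝ) 1)).prod
          ((volume.restrict (Set.Icc (0:ℝ) 1)).prod (volume.restrict (Set.Icc (0:ℝ) 1)))),
        ∫ x in Set.Icc (0:ℝ) 1, g (σ (q.1, q.2.1, q.2.2, x))
          = ∫ u' in Set.Icc (0:ℝ) 1, ∫ x in Set.Icc (0:ℝ) 1, g (σ (q.1, u', q.2.2, x)))) :
    ∀ n : ℕ, 1 ≤ n → ∀ g : (Fin n → ℝ) → ℝ, ContinuousOn g {y | ∀ i, y i ∈ S} →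
      (∀ᵐ q : ℝ × (Fin n → ℝ) ∂((volume.restrict (Set.Icc (0:ℝ) 1)).prod
          (Measure.pi fun _ : Fin n => volume.restrict (Set.Icc (0:ℝ) 1))),
        (∫ u in Set.Icc (0:ℝ) 1,
            ∫ x : Fin n → ℝ, g (fun i => σ (q.1, u, q.2 i, x i))
              ∂(Measure.pi fun _ : Fin n => volume.restrict (Set.Icc (0:ℝ) 1)))
          = ∫ u : Fin n → ℝ,
              (∫ x : Fin n → ℝ, g (fun i => σ (q.1, u i, q.2 i, x i))
                ∂(Measure.pi fun _ : Fin n => volume.restrict (Set.Icc (0:ℝ) 1)))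
              ∂(Measure.pi fun _ : Fin n => volume.restrict (Set.Icc (0:ℝ) 1))) := by
  intro n _ g hg
  have : IsProbabilityMeasure (volume.restrict (Set.Icc (0 : ℝ) 1)) := ⟨by simp⟩
  set P : Measure ℝ := volume.restrict (Set.Icc (0 : ℝ) 1) with hP
  have hlaw := ae_ae_of_ae_prod_prod P <| ae_map_eq_map_of_forall_integral_eq P hσmeas fun f =>
    hsingle (fun y => (f y : ℝ)) (NNReal.continuous_coe.comp f.continuous).continuousOn
  have hall : ∀ᵐ q : ℝ × (Fin n → ℝ) ∂(P.prod (Measure.pi fun _ => P)), ∀ i, ∀ᵐ u ∂P,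
      P.map (fun x => σ (q.1, u, q.2 i, x))
        = (P.prod P).map (fun p : ℝ × ℝ => σ (q.1, p.1, q.2 i, p.2)) :=
    ae_all_iff.2 fun i => ((MeasurePreserving.id P).prod
      (measurePreserving_eval (fun _ : Fin n => P) i)).quasiMeasurePreserving.ae hlaw
  filter_upwards [hall] with q hq
  have key (u : Fin n → ℝ) (hu : ∀ i, P.map (fun x => σ (q.1, u i, q.2 i, x))
      = (P.prod P).map (fun p : ℝ × ℝ => σ (q.1, p.1, q.2 i, p.2))) :
      ∫ x : Fin n → ℝ, g (fun i => σ (q.1, u i, q.2 i, x i)) ∂(Measure.pi fun _ => P)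
        = ∫ y, Set.indicator {y | ∀ i, y i ∈ S} g y ∂(Measure.pi fun i =>
            (P.prod P).map (fun p : ℝ × ℝ => σ (q.1, p.1, q.2 i, p.2))) := by
    rw [integral_pi_comp_eq_integral_pi_map P hS.isClosed hg
      (f := fun i x => σ (q.1, u i, q.2 i, x)) (fun i => by fun_prop) fun i x => hσmem _]
    simp_rw [hu]
  rw [integral_congr_ae ((ae_all_iff.2 hq).mono fun u hu => key (fun _ => u) hu),
    integral_congr_ae ((ae_all_iff.2 fun i => (measurePreserving_eval (fun _ : Fin n => P)
      i).quasiMeasurePreserving.ae (hq i)).mono key)]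
  simp
end

section
/- For every β > 0 there exists a constant K > 0 depending only on α and β (and not on N, Σ, ν, ψ or μ_θ) such that for all N ≥ 1, E|F_N(β) − E F_N(β)| ≤ K·N^{−1/2}·(∫‖θ‖∞² μ_θ(dθ))^{1/2}. -/
open MeasureTheory Filter
open scoped ENNReal NNReal ProbabilityTheory

namespace DilutedSpinGlass

variable {S : Set ℝ}

/-- The diluted Hamiltonian
`H_N(σ) = Σ_{k ≤ π(αN)} θ_k(σ_{I(k,1)},…,σ_{I(k,p)}) + Σ_{i=1}^N ψ(σ_i)`. -/
noncomputable def hamiltonian (p N : ℕ) {Ω : Type*} (ψ : C(↥S, ℝ)) (K : Ω → ℕ)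
    (θR : ℕ → Ω → C((Fin p → ↥S), ℝ)) (IR : ℕ → Ω → (Fin p → Fin N)) (ω : Ω)
    (σ : Fin N → ↥S) : ℝ :=
  (∑ k ∈ Finset.range (K ω), θR k ω (fun j => σ (IR k ω j))) + ∑ i, ψ (σ i)

/-- The free energy `F_N(β) = N⁻¹ log ∫ exp(β H_N(σ)) ν^{⊗N}(dσ)`. -/
noncomputable def freeEnergy (p N : ℕ) {Ω : Type*} (β : ℝ) (ψ : C(↥S, ℝ)) (ν : Measure ↥S)
    (K : Ω → ℕ) (θR : ℕ → Ω → C((Fin p → ↥S), ℝ)) (IR : ℕ → Ω → (Fin p → Fin N))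
    (ω : Ω) : ℝ :=
  (N : ℝ)⁻¹ * Real.log (∫ σ : Fin N → ↥S,
    Real.exp (β * hamiltonian p N ψ K θR IR ω σ) ∂(Measure.pi fun _ : Fin N => ν))

section EfronStein

variable {X : Type*} [MeasurableSpace X] {μ : Measure X} [IsProbabilityMeasure μ] {d : X → ℝ}

lemma sq_integral_le_integral_sq {Y : Type*} [MeasurableSpace Y] {P : Measure Y}
    [IsProbabilityMeasure P] {f : Y → ℝ} (hf : MemLp f 2 P) :
    (∫ y, f y ∂P) ^ 2 ≤ ∫ y, f y ^ 2 ∂P := by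
  have h := ProbabilityTheory.variance_nonneg f P
  rw [ProbabilityTheory.variance_eq_sub hf] at h
  simpa using h

lemma integral_sq_sub_integral_le {Y : Type*} [MeasurableSpace Y] {P : Measure Y}
    [IsProbabilityMeasure P] {f : Y → ℝ} (hf : MemLp f 2 P) (c : ℝ) :
    ∫ y, (f y - ∫ z, f z ∂P) ^ 2 ∂P ≤ ∫ y, (f y - c) ^ 2 ∂P := by
  rw [← ProbabilityTheory.variance_eq_integral hf.1.aemeasurable,
    ← ProbabilityTheory.variance_sub_const hf.1 c]
  exact ProbabilityTheory.variance_le_expectation_sq (hf.1.sub aestronglyMeasurable_const)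

lemma measurePreserving_cons (μ : Measure X) [IsProbabilityMeasure μ] (n : ℕ) :
    MeasurePreserving (fun q : X × (Fin n → X) => (Fin.cons q.1 q.2 : Fin (n + 1) → X))
      (μ.prod (Measure.pi fun _ => μ)) (Measure.pi fun _ => μ) := by
  have h := (measurePreserving_piFinSuccAbove (n := n) (fun _ => μ) 0).symm
  convert h using 1
  ext q : 1
  exact (Fin.insertNth_zero' q.1 q.2).symm

lemma integral_pi_succ (n : ℕ) (f : (Fin (n + 1) → X) → ℝ) :
    ∫ q : X × (Fin n → X), f (Fin.cons q.1 q.2) ∂(μ.prod (Measure.pi fun _ => μ))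
      = ∫ x, f x ∂(Measure.pi fun _ => μ) := by
  rw [← (measurePreserving_piFinSuccAbove (n := n) (fun _ : Fin (n + 1) => μ) 0).symm.integral_comp
    (MeasurableEquiv.measurableEmbedding _) f]
  refine integral_congr_ae (ae_of_all _ fun q => ?_)
  exact congrArg f (Fin.insertNth_zero' q.1 q.2).symm

lemma integrable_slice {Y : Type*} [MeasurableSpace Y] (hd : Integrable d μ) {φ : X × Y → ℝ}
    (hφ : Measurable φ) (hφd : ∀ a a' y, |φ (a, y) - φ (a', y)| ≤ d a + d a') (y : Y) :
    Integrable (fun a => φ (a, y)) μ := by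
  obtain ⟨a₀⟩ : Nonempty X := nonempty_of_isProbabilityMeasure μ
  have h : Integrable (fun a => φ (a, y) - φ (a₀, y)) μ :=
    (hd.add (integrable_const (d a₀))).mono'
      ((hφ.comp measurable_prodMk_right).sub_const _).aestronglyMeasurable
      (ae_of_all _ fun a => hφd a a₀ y)
  exact (h.add (integrable_const (φ (a₀, y)))).congr (ae_of_all _ fun a => by simp)

/-- An integration over one coordinate splits the mean square deviation. -/
lemma integral_sq_deviation_prod {Y : Type*} [MeasurableSpace Y] {P : Measure Y}
    [IsProbabilityMeasure P] (hd : MemLp d 2 μ) {φ : X × Y → ℝ} (hφ : Measurable φ)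
    (hφd : ∀ a a' y, |φ (a, y) - φ (a', y)| ≤ d a + d a')
    (hg : MemLp (fun y => ∫ a, φ (a, y) ∂μ) 2 P) (c : ℝ) :
    MemLp φ 2 (μ.prod P) ∧
      ∫ q, (φ q - c) ^ 2 ∂(μ.prod P)
        ≤ 4 * ∫ a, d a ^ 2 ∂μ + ∫ y, ((∫ a, φ (a, y) ∂μ) - c) ^ 2 ∂P := by
  set g : Y → ℝ := fun y => ∫ a, φ (a, y) ∂μ with hgdef
  set D : ℝ := ∫ a, d a ∂μ with hD
  have hd1 : Integrable d μ := hd.integrable (by norm_num)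
  have hint : ∀ y, Integrable (fun a => φ (a, y)) μ := integrable_slice hd1 hφ hφd
  have hgm : Measurable g := (hφ.stronglyMeasurable.integral_prod_left').measurable
  have hub : ∀ a y, |φ (a, y) - g y| ≤ d a + D := by
    intro a y
    have h1 : φ (a, y) - g y = ∫ a', (φ (a, y) - φ (a', y)) ∂μ := by
      rw [integral_sub (integrable_const _) (hint y)]; simp [hgdef]
    have h2 : d a + D = ∫ a', (d a + d a') ∂μ := by
      rw [integral_add (integrable_const _) hd1]; simp [hD]
    rw [h1, h2]
    exact (abs_integral_le_integral_abs).trans (integral_mono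
      ((integrable_const _).sub (hint y)).abs ((integrable_const _).add hd1) fun a' => hφd a a' y)
  have hdD : MemLp (fun q : X × Y => d q.1 + D) 2 (μ.prod P) :=
    (hd.add (memLp_const D)).comp_measurePreserving measurePreserving_fst
  have hum : Measurable fun q : X × Y => φ q - g q.2 := hφ.sub (hgm.comp measurable_snd)
  have hu : MemLp (fun q : X × Y => φ q - g q.2) 2 (μ.prod P) :=
    hdD.mono hum.aestronglyMeasurable (ae_of_all _ fun q => by
      rw [Real.norm_eq_abs, Real.norm_eq_abs]
      exact (hub q.1 q.2).trans (le_abs_self _))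
  have hg2 : MemLp (fun q : X × Y => g q.2) 2 (μ.prod P) :=
    hg.comp_measurePreserving measurePreserving_snd
  have hv : MemLp (fun q : X × Y => g q.2 - c) 2 (μ.prod P) := hg2.sub (memLp_const c)
  refine ⟨(memLp_congr_ae (ae_of_all _ fun q => by simp)).1 (hu.add hg2), ?_⟩
  have huv : Integrable (fun q : X × Y => (φ q - g q.2) * (g q.2 - c)) (μ.prod P) :=
    hu.integrable_mul hv
  have hcross : ∫ q : X × Y, (φ q - g q.2) * (g q.2 - c) ∂(μ.prod P) = 0 := by
    rw [integral_prod_symm _ huv]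
    refine integral_eq_zero_of_ae (ae_of_all _ fun y => ?_)
    simp only [Pi.zero_apply]
    rw [integral_mul_const, integral_sub (hint y) (integrable_const _)]
    simp [hgdef]
  have hsplit : ∫ q, (φ q - c) ^ 2 ∂(μ.prod P)
      = ∫ q : X × Y, (φ q - g q.2) ^ 2 ∂(μ.prod P)
        + ∫ q : X × Y, (g q.2 - c) ^ 2 ∂(μ.prod P) := by
    have : ∀ q : X × Y, (φ q - c) ^ 2
        = ((φ q - g q.2) ^ 2 + (g q.2 - c) ^ 2) + 2 * ((φ q - g q.2) * (g q.2 - c)) := by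
      intro q; ring
    simp_rw [this]
    rw [integral_add (by exact hu.integrable_sq.add hv.integrable_sq) (huv.const_mul 2),
      integral_add hu.integrable_sq hv.integrable_sq, integral_const_mul, hcross]
    ring
  have hlast : ∫ q : X × Y, (g q.2 - c) ^ 2 ∂(μ.prod P) = ∫ y, (g y - c) ^ 2 ∂P := by
    simpa using integral_fun_snd (μ := μ) (ν := P) (fun y => (g y - c) ^ 2)
  have hfirst : ∫ q : X × Y, (φ q - g q.2) ^ 2 ∂(μ.prod P) ≤ 4 * ∫ a, d a ^ 2 ∂μ := by
    have hDsq : D ^ 2 ≤ ∫ a, d a ^ 2 ∂μ := sq_integral_le_integral_sq hd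
    calc ∫ q : X × Y, (φ q - g q.2) ^ 2 ∂(μ.prod P)
        ≤ ∫ q : X × Y, (d q.1 + D) ^ 2 ∂(μ.prod P) :=
          integral_mono hu.integrable_sq hdD.integrable_sq fun q =>
            sq_le_sq.2 ((hub q.1 q.2).trans (le_abs_self _))
      _ = ∫ a, (d a + D) ^ 2 ∂μ := by
          simpa using integral_fun_fst (μ := μ) (ν := P) (fun a => (d a + D) ^ 2)
      _ ≤ ∫ a, (2 * d a ^ 2 + 2 * D ^ 2) ∂μ :=
          integral_mono (hd.add (memLp_const D)).integrable_sq
            ((hd.integrable_sq.const_mul 2).add (integrable_const _)) fun a => by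
              simp only
              nlinarith [sq_nonneg (d a - D)]
      _ = 2 * ∫ a, d a ^ 2 ∂μ + 2 * D ^ 2 := by
          rw [integral_add (hd.integrable_sq.const_mul 2) (integrable_const _), integral_const_mul]
          simp
      _ ≤ 4 * ∫ a, d a ^ 2 ∂μ := by linarith
  rw [hsplit, hlast]
  linarith

/-- A form of the Efron–Stein inequality: if replacing one coordinate `a` by `b` moves `f` by at
most `d a + d b`, then the variance of `f` grows at most linearly in the number of coordinates. -/
theorem variance_le_of_update (hd : MemLp d 2 μ) (n : ℕ) :
    ∀ {f : (Fin n → X) → ℝ}, Measurable f →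
      (∀ x k b, |f (Function.update x k b) - f x| ≤ d b + d (x k)) →
      MemLp f 2 (Measure.pi fun _ => μ) ∧
        ∫ x, (f x - ∫ y, f y ∂(Measure.pi fun _ => μ)) ^ 2 ∂(Measure.pi fun _ => μ)
          ≤ n * (4 * ∫ a, d a ^ 2 ∂μ) := by
  induction n with
  | zero =>
    intro f _ _
    obtain ⟨c, rfl⟩ : ∃ c : ℝ, f = fun _ => c :=
      ⟨f finZeroElim, funext fun x => congrArg f (Subsingleton.elim _ _)⟩
    exact ⟨memLp_const _, by simp⟩
  | succ n ih =>
    intro f hf hfd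
    have hd1 : Integrable d μ := hd.integrable (by norm_num)
    set φ : X × (Fin n → X) → ℝ := fun q => f (Fin.cons q.1 q.2) with hφdef
    have hφ : Measurable φ := hf.comp (measurePreserving_cons μ n).measurable
    have hφ0 : ∀ a a' y, |φ (a, y) - φ (a', y)| ≤ d a + d a' := by
      intro a a' y
      simpa [hφdef, Fin.update_cons_zero] using hfd (Fin.cons a' y) 0 a
    have hint : ∀ y, Integrable (fun a => φ (a, y)) μ := integrable_slice hd1 hφ hφ0
    set g : (Fin n → X) → ℝ := fun y => ∫ a, φ (a, y) ∂μ with hgdef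
    have hgm : Measurable g := (hφ.stronglyMeasurable.integral_prod_left').measurable
    have hgd : ∀ x k b, |g (Function.update x k b) - g x| ≤ d b + d (x k) := by
      intro x k b
      have h1 : g (Function.update x k b) - g x
          = ∫ a, (φ (a, Function.update x k b) - φ (a, x)) ∂μ :=
        (integral_sub (hint _) (hint _)).symm
      have h2 : d b + d (x k) = ∫ _a, (d b + d (x k)) ∂μ := by simp
      rw [h1, h2]
      refine (abs_integral_le_integral_abs).trans (integral_mono
        ((hint _).sub (hint _)).abs (integrable_const _) fun a => ?_)
      simpa [hφdef, Fin.cons_update] using hfd (Fin.cons a x) k.succ b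
    obtain ⟨hgL, hgV⟩ := ih hgm hgd
    have hm : ∫ x, f x ∂(Measure.pi fun _ => μ) = ∫ y, g y ∂(Measure.pi fun _ => μ) := by
      have hφL := (integral_sq_deviation_prod hd hφ hφ0 hgL 0).1
      rw [← integral_pi_succ, integral_prod_symm _ (hφL.integrable (by norm_num))]
    obtain ⟨hφL, hφV⟩ := integral_sq_deviation_prod hd hφ hφ0 hgL
      (∫ y, g y ∂(Measure.pi fun _ => μ))
    refine ⟨?_, ?_⟩
    · have hmp := measurePreserving_cons μ n
      rw [← hmp.map_eq]
      exact (memLp_map_measure_iff hf.aestronglyMeasurable hmp.aemeasurable).2 hφL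
    · rw [hm, ← integral_pi_succ n fun x => (f x - ∫ y, g y ∂(Measure.pi fun _ => μ)) ^ 2]
      refine hφV.trans ?_
      push_cast
      linarith

end EfronStein

section Poisson

open Real

lemma hasSum_poisson_mul (r : ℝ≥0) :
    HasSum (fun n : ℕ => exp (-r) * r ^ n / n.factorial * n) r := by
  rw [← hasSum_nat_add_iff' 1]
  have h := (ProbabilityTheory.hasSum_one_poissonMeasure r).mul_left (r : ℝ)
  simp only [Finset.range_one, Finset.sum_singleton, Nat.cast_zero, mul_zero, sub_zero]
  refine HasSum.congr_fun (by simpa using h) fun n => ?_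
  rw [Nat.factorial_succ]
  push_cast
  field_simp
  ring

lemma hasSum_poisson_mul_sub_sq (r : ℝ≥0) :
    HasSum (fun n : ℕ => exp (-r) * r ^ n / n.factorial * ((n : ℝ) - r) ^ 2) r := by
  have h2 : HasSum (fun n : ℕ => exp (-r) * r ^ n / n.factorial * (n * (n - 1))) ((r : ℝ) ^ 2) := by
    rw [← hasSum_nat_add_iff' 1]
    have h := (hasSum_poisson_mul r).mul_left (r : ℝ)
    simp only [Finset.range_one, Finset.sum_singleton, Nat.cast_zero, zero_mul, mul_zero, sub_zero]
    rw [pow_two]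
    refine HasSum.congr_fun h fun n => ?_
    rw [Nat.factorial_succ]
    push_cast
    field_simp
    ring
  have h := (h2.add ((hasSum_poisson_mul r).mul_left (1 - 2 * (r : ℝ)))).add
    ((ProbabilityTheory.hasSum_one_poissonMeasure r).mul_left ((r : ℝ) ^ 2))
  convert h using 1
  · ext n; ring
  · ring

end Poisson

section PoissonMixture

variable {X : Type*} [MeasurableSpace X] {μ : Measure X} [IsProbabilityMeasure μ] {d : X → ℝ}

lemma exists_abs_sub_le_mul_abs_sub {m : ℕ → ℝ} {L : ℝ} (hm : ∀ n, |m (n + 1) - m n| ≤ L)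
    (r : ℝ) : ∃ c, ∀ n : ℕ, |m n - c| ≤ L * |(n : ℝ) - r| := by
  have hL : 0 ≤ L := (abs_nonneg _).trans (hm 0)
  have hlip : LipschitzWith L.toNNReal m := by
    refine LipschitzWith.of_dist_le_mul fun a b => ?_
    wlog hab : a ≤ b generalizing a b
    · rw [dist_comm, dist_comm a]
      exact this b a (le_of_not_ge hab)
    have h := dist_le_Ico_sum_of_dist_le (f := m) (d := fun _ => L) hab
      fun {k} _ _ => by rw [dist_comm, Real.dist_eq]; exact hm k
    refine h.trans (le_of_eq ?_)
    have hab' : (a : ℝ) ≤ b := by exact_mod_cast hab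
    rw [Nat.dist_eq, abs_sub_comm, abs_of_nonneg (sub_nonneg.2 hab'), Real.coe_toNNReal _ hL]
    simp [Nat.cast_sub hab, mul_comm]
  have hon : LipschitzOnWith L.toNNReal (fun t : ℝ => m ⌊t⌋₊) (Set.range ((↑) : ℕ → ℝ)) := by
    refine LipschitzOnWith.of_dist_le_mul ?_
    rintro _ ⟨a, rfl⟩ _ ⟨b, rfl⟩
    simpa using hlip.dist_le_mul a b
  obtain ⟨g, hg, hgm⟩ := hon.extend_real
  refine ⟨g r, fun n => ?_⟩
  have h := hg.dist_le_mul (n : ℝ) r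
  rw [← hgm ⟨n, rfl⟩] at h
  simpa [Real.dist_eq, Real.coe_toNNReal _ hL] using h

/-- Mean absolute deviation of a functional of a Poisson number of i.i.d. inputs. -/
theorem integral_abs_sub_integral_le_of_poisson (hd : MemLp d 2 μ)
    {G : ∀ n : ℕ, (Fin n → X) → ℝ} (hG : ∀ n, Measurable (G n))
    (hGu : ∀ n x k b, |G n (Function.update x k b) - G n x| ≤ d b + d (x k))
    (hGc : ∀ n a (y : Fin n → X), |G (n + 1) (Fin.cons a y) - G n y| ≤ d a)
    {Ω : Type*} [MeasurableSpace Ω] {P : Measure Ω} [IsProbabilityMeasure P]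
    {K : Ω → ℕ} {Y : ℕ → Ω → X} {r : ℝ≥0}
    (hlaw : ∀ n : ℕ, P.map (fun ω => (K ω, fun k : Fin n => Y k ω))
      = (ProbabilityTheory.poissonMeasure r).prod (Measure.pi fun _ => μ))
    {F : Ω → ℝ} (hFG : ∀ ω, F ω = G (K ω) fun k => Y k ω) :
    ∫ ω, |F ω - ∫ ω', F ω' ∂P| ∂P ≤ √(5 * r * ∫ a, d a ^ 2 ∂μ) := by
  have haem : ∀ n, AEMeasurable (fun ω => (K ω, fun k : Fin n => Y k ω)) P := fun n =>
    AEMeasurable.of_map_ne_zero (by rw [hlaw n]; exact IsProbabilityMeasure.ne_zero _)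
  have hKs : ∀ n, NullMeasurableSet (K ⁻¹' {n}) P := fun n =>
    (measurable_fst.comp_aemeasurable (haem 0)).nullMeasurableSet_preimage
      (measurableSet_singleton n)
  have hcover : ⋃ n, K ⁻¹' {n} = Set.univ := by
    ext ω; simp
  have hFn : ∀ n, ∀ᵐ ω ∂P.restrict (K ⁻¹' {n}), F ω = G n fun k => Y k ω := by
    intro n
    filter_upwards [ae_restrict_mem₀ (hKs n)] with ω hω
    obtain rfl : K ω = n := hω
    exact hFG ω
  have hF : AEMeasurable F P := by
    rw [← Measure.restrict_univ (μ := P), ← hcover]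
    refine aemeasurable_iUnion_iff.2 fun n => ?_
    exact ((((hG n).comp measurable_snd).comp_aemeasurable (haem n)).restrict).congr
      ((hFn n).mono fun ω h => h.symm)
  have hD2 : 0 ≤ ∫ a, d a ^ 2 ∂μ := integral_nonneg fun _ => sq_nonneg _
  have hd1 : Integrable d μ := hd.integrable (by norm_num)
  have hES := fun n => variance_le_of_update hd n (hG n) (hGu n)
  have hGint : ∀ n, Integrable (G n) (Measure.pi fun _ => μ) := fun n =>
    (hES n).1.integrable (by norm_num)
  obtain ⟨c, hc⟩ : ∃ c, ∀ n : ℕ, |∫ x, G n x ∂(Measure.pi fun _ => μ) - c|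
      ≤ (∫ a, d a ∂μ) * |(n : ℝ) - r| := by
    refine exists_abs_sub_le_mul_abs_sub (fun n => ?_) _
    have hsnd := integral_fun_snd (μ := μ) (ν := Measure.pi fun _ : Fin n => μ) (G n)
    have hfst := integral_fun_fst (μ := μ) (ν := Measure.pi fun _ : Fin n => μ) d
    simp only [probReal_univ, one_smul] at hsnd hfst
    have hi : Integrable (fun q : X × (Fin n → X) => G (n + 1) (Fin.cons q.1 q.2))
        (μ.prod (Measure.pi fun _ => μ)) :=
      (measurePreserving_cons μ n).integrable_comp_of_integrable (hGint (n + 1))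
    have hi' : Integrable (fun q : X × (Fin n → X) => G n q.2)
        (μ.prod (Measure.pi fun _ => μ)) := (hGint n).comp_snd μ
    rw [← integral_pi_succ, ← hsnd, ← hfst, ← integral_sub hi hi']
    exact abs_integral_le_integral_abs.trans (integral_mono (hi.sub hi').abs
      (hd1.comp_fst _) fun q => hGc n q.1 q.2)
  have hslice : ∀ n : ℕ, ∫ x, (G n x - c) ^ 2 ∂(Measure.pi fun _ => μ)
      ≤ (∫ a, d a ^ 2 ∂μ) * (4 * n + ((n : ℝ) - r) ^ 2) := by
    intro n
    obtain ⟨hL, hV⟩ := hES n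
    have h1 : ∫ x, (G n x - c) ^ 2 ∂(Measure.pi fun _ => μ)
        = ∫ x, (G n x - ∫ y, G n y ∂(Measure.pi fun _ => μ)) ^ 2 ∂(Measure.pi fun _ => μ)
          + (∫ y, G n y ∂(Measure.pi fun _ => μ) - c) ^ 2 := by
      set m := ∫ y, G n y ∂(Measure.pi fun _ => μ) with hm
      have hLm : MemLp (fun x => G n x - m) 2 (Measure.pi fun _ => μ) := hL.sub (memLp_const m)
      have : ∀ x, (G n x - c) ^ 2
          = (G n x - m) ^ 2 + (2 * (m - c) * (G n x - m) + (m - c) ^ 2) := by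
        intro x; ring
      simp_rw [this]
      have hi := hLm.integrable (by norm_num)
      rw [integral_add hLm.integrable_sq (by exact (hi.const_mul _).add (integrable_const _)),
        integral_add (hi.const_mul _) (integrable_const _), integral_const_mul,
        integral_sub (hGint n) (integrable_const _)]
      simp [← hm]
    have h2 : (∫ y, G n y ∂(Measure.pi fun _ => μ) - c) ^ 2
        ≤ (∫ a, d a ^ 2 ∂μ) * ((n : ℝ) - r) ^ 2 := by
      calc _ ≤ ((∫ a, d a ∂μ) * |(n : ℝ) - r|) ^ 2 :=
            sq_le_sq.2 ((hc n).trans (le_abs_self _))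
        _ = (∫ a, d a ∂μ) ^ 2 * ((n : ℝ) - r) ^ 2 := by rw [mul_pow, sq_abs]
        _ ≤ _ := mul_le_mul_of_nonneg_right (sq_integral_le_integral_sq hd) (sq_nonneg _)
    rw [h1]
    linarith
  have hsum : ∫⁻ ω, ENNReal.ofReal ((F ω - c) ^ 2) ∂P
      ≤ ENNReal.ofReal (5 * r * ∫ a, d a ^ 2 ∂μ) := by
    have hterm : ∀ n : ℕ, ∫⁻ ω in K ⁻¹' {n}, ENNReal.ofReal ((F ω - c) ^ 2) ∂P
        ≤ ENNReal.ofReal (Real.exp (-r) * r ^ n / n.factorial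
          * ((∫ a, d a ^ 2 ∂μ) * (4 * n + ((n : ℝ) - r) ^ 2))) := by
      intro n
      set h : (Fin n → X) → ℝ≥0∞ := fun x => ENNReal.ofReal ((G n x - c) ^ 2) with hh
      have hhm : Measurable h := (((hG n).sub_const c).pow_const 2).ennreal_ofReal
      calc ∫⁻ ω in K ⁻¹' {n}, ENNReal.ofReal ((F ω - c) ^ 2) ∂P
          = ∫⁻ ω in K ⁻¹' {n}, h (fun k => Y k ω) ∂P :=
            lintegral_congr_ae ((hFn n).mono fun ω hω => by simp only [hω, hh])
        _ = ∫⁻ ω, ({n} : Set ℕ).indicator 1 (K ω) * h (fun k => Y k ω) ∂P := by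
            rw [← lintegral_indicator₀ (hKs n)]
            refine lintegral_congr fun ω => ?_
            by_cases hω : K ω = n <;> simp [Set.indicator, hω]
        _ = ∫⁻ q : ℕ × (Fin n → X), ({n} : Set ℕ).indicator 1 q.1 * h q.2
              ∂((ProbabilityTheory.poissonMeasure r).prod (Measure.pi fun _ => μ)) := by
            rw [← hlaw n, lintegral_map' _ (haem n)]
            exact (((measurable_one.indicator (measurableSet_singleton n)).comp
              measurable_fst).mul (hhm.comp measurable_snd)).aemeasurable
        _ = ENNReal.ofReal (Real.exp (-r) * r ^ n / n.factorial)
              * ∫⁻ x, h x ∂(Measure.pi fun _ => μ) := by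
            rw [lintegral_prod_mul (measurable_one.indicator
              (measurableSet_singleton n)).aemeasurable hhm.aemeasurable,
              lintegral_indicator_one (measurableSet_singleton n),
              ProbabilityTheory.poissonMeasure_singleton]
        _ ≤ _ := by
            have hint : Integrable (fun x => (G n x - c) ^ 2) (Measure.pi fun _ => μ) :=
              ((hES n).1.sub (memLp_const c)).integrable_sq
            rw [hh, ← ofReal_integral_eq_lintegral_ofReal hint (ae_of_all _ fun _ => sq_nonneg _),
              ← ENNReal.ofReal_mul (by positivity)]
            exact ENNReal.ofReal_le_ofReal
              (mul_le_mul_of_nonneg_left (hslice n) (by positivity))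
    have hS : ∀ D : ℝ, HasSum (fun n : ℕ => Real.exp (-r) * r ^ n / n.factorial
          * (D * (4 * n + ((n : ℝ) - r) ^ 2))) (5 * r * D) := by
      intro D
      have h := (((hasSum_poisson_mul r).mul_left 4).add (hasSum_poisson_mul_sub_sq r)).mul_left D
      rw [show D * (4 * (r : ℝ) + r) = 5 * r * D by ring] at h
      exact h.congr_fun fun n => by ring
    rw [← setLIntegral_univ, ← hcover, lintegral_iUnion₀ hKs ?_, ← (hS _).tsum_eq,
      ENNReal.ofReal_tsum_of_nonneg (fun n => by positivity) (hS _).summable]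
    · exact ENNReal.tsum_le_tsum hterm
    · intro i j hij
      refine Disjoint.aedisjoint (Set.disjoint_left.2 ?_)
      rintro ω rfl h
      exact hij h
  have hFc : MemLp (fun ω => F ω - c) 2 P := by
    have hm : AEStronglyMeasurable (fun ω => F ω - c) P := (hF.sub_const c).aestronglyMeasurable
    refine (memLp_two_iff_integrable_sq hm).2 ⟨hm.pow 2, ?_⟩
    rw [hasFiniteIntegral_iff_ofReal (ae_of_all _ fun _ => sq_nonneg _)]
    exact hsum.trans_lt ENNReal.ofReal_lt_top
  have hFL : MemLp F 2 P :=
    (memLp_congr_ae (ae_of_all _ fun ω => by simp)).1 (hFc.add (memLp_const c))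
  have hFsub : MemLp (fun ω => F ω - ∫ ω', F ω' ∂P) 2 P := hFL.sub (memLp_const _)
  refine Real.le_sqrt_of_sq_le ?_
  calc (∫ ω, |F ω - ∫ ω', F ω' ∂P| ∂P) ^ 2
      ≤ ∫ ω, |F ω - ∫ ω', F ω' ∂P| ^ 2 ∂P := sq_integral_le_integral_sq hFsub.abs
    _ = ∫ ω, (F ω - ∫ ω', F ω' ∂P) ^ 2 ∂P := by simp_rw [sq_abs]
    _ ≤ ∫ ω, (F ω - c) ^ 2 ∂P := integral_sq_sub_integral_le hFL c
    _ ≤ 5 * r * ∫ a, d a ^ 2 ∂μ := by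
        rw [integral_eq_lintegral_of_nonneg_ae (ae_of_all _ fun _ => sq_nonneg _)
          hFc.integrable_sq.1]
        exact ENNReal.toReal_le_of_le_ofReal (by positivity) hsum

end PoissonMixture

section FreeEnergy

lemma abs_log_integral_exp_sub_le {Y : Type*} [TopologicalSpace Y] [CompactSpace Y]
    [MeasurableSpace Y] [OpensMeasurableSpace Y] {P : Measure Y} [IsProbabilityMeasure P]
    {f g : Y → ℝ} (hf : Continuous f) (hg : Continuous g) {δ : ℝ} (h : ∀ y, |f y - g y| ≤ δ) :
    |Real.log (∫ y, Real.exp (f y) ∂P) - Real.log (∫ y, Real.exp (g y) ∂P)| ≤ δ := by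
  have key : ∀ {f g : Y → ℝ}, Continuous f → Continuous g → (∀ y, f y ≤ δ + g y) →
      Real.log (∫ y, Real.exp (f y) ∂P) ≤ δ + Real.log (∫ y, Real.exp (g y) ∂P) := by
    intro f g hf hg h
    have hi : ∀ {u : Y → ℝ}, Continuous u → Integrable (fun y => Real.exp (u y)) P := fun hu =>
      (Real.continuous_exp.comp hu).integrable_of_hasCompactSupport
        (HasCompactSupport.of_compactSpace _)
    have hle : ∫ y, Real.exp (f y) ∂P ≤ Real.exp δ * ∫ y, Real.exp (g y) ∂P := by
      rw [← integral_const_mul]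
      refine integral_mono (hi hf) ((hi hg).const_mul _) fun y => ?_
      simp only
      rw [← Real.exp_add]
      exact Real.exp_le_exp.2 (h y)
    refine (Real.log_le_log (integral_exp_pos (hi hf)) hle).trans (le_of_eq ?_)
    rw [Real.log_mul (Real.exp_ne_zero _) (integral_exp_pos (hi hg)).ne', Real.log_exp]
  rw [abs_sub_le_iff]
  constructor
  · linarith [key hf hg fun y => by linarith [(abs_sub_le_iff.1 (h y)).1]]
  · linarith [key hg hf fun y => by linarith [(abs_sub_le_iff.1 (h y)).2]]

variable {p N : ℕ}

/-- The Hamiltonian with a given finite list of interactions. -/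
noncomputable def finiteHamiltonian (ψ : C(↥S, ℝ)) {n : ℕ}
    (x : Fin n → C((Fin p → ↥S), ℝ) × (Fin p → Fin N)) (σ : Fin N → ↥S) : ℝ :=
  (∑ k, (x k).1 (fun j => σ ((x k).2 j))) + ∑ i, ψ (σ i)

/-- The free energy with a given finite list of interactions. -/
noncomputable def finiteFreeEnergy (β : ℝ) (ψ : C(↥S, ℝ)) (ν : Measure ↥S) (n : ℕ)
    (x : Fin n → C((Fin p → ↥S), ℝ) × (Fin p → Fin N)) : ℝ :=
  (N : ℝ)⁻¹ * Real.log (∫ σ : Fin N → ↥S,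
    Real.exp (β * finiteHamiltonian ψ x σ) ∂(Measure.pi fun _ : Fin N => ν))

lemma freeEnergy_eq_finiteFreeEnergy {Ω : Type*} (β : ℝ) (ψ : C(↥S, ℝ)) (ν : Measure ↥S)
    (K : Ω → ℕ) (θR : ℕ → Ω → C((Fin p → ↥S), ℝ)) (IR : ℕ → Ω → (Fin p → Fin N)) (ω : Ω) :
    freeEnergy p N β ψ ν K θR IR ω
      = finiteFreeEnergy β ψ ν (K ω) fun k => (θR k ω, IR k ω) := by
  simp only [freeEnergy, finiteFreeEnergy, hamiltonian, finiteHamiltonian, Finset.sum_range]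

lemma continuous_finiteHamiltonian (ψ : C(↥S, ℝ)) {n : ℕ}
    (x : Fin n → C((Fin p → ↥S), ℝ) × (Fin p → Fin N)) : Continuous (finiteHamiltonian ψ x) := by
  unfold finiteHamiltonian
  fun_prop

lemma abs_finiteFreeEnergy_sub_le [CompactSpace ↥S] {ν : Measure ↥S} [IsProbabilityMeasure ν]
    {β : ℝ} (hβ : 0 ≤ β) (ψ : C(↥S, ℝ)) {n m : ℕ}
    {x : Fin n → C((Fin p → ↥S), ℝ) × (Fin p → Fin N)}
    {y : Fin m → C((Fin p → ↥S), ℝ) × (Fin p → Fin N)} {δ : ℝ}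
    (h : ∀ σ, |finiteHamiltonian ψ x σ - finiteHamiltonian ψ y σ| ≤ δ) :
    |finiteFreeEnergy β ψ ν n x - finiteFreeEnergy β ψ ν m y| ≤ β / N * δ := by
  have := abs_log_integral_exp_sub_le (P := Measure.pi fun _ : Fin N => ν)
    (f := fun σ => β * finiteHamiltonian ψ x σ) (g := fun σ => β * finiteHamiltonian ψ y σ)
    (continuous_const.mul (continuous_finiteHamiltonian ψ x))
    (continuous_const.mul (continuous_finiteHamiltonian ψ y)) (δ := β * δ) fun σ => by
      rw [← mul_sub, abs_mul, abs_of_nonneg hβ]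
      exact mul_le_mul_of_nonneg_left (h σ) hβ
  rw [finiteFreeEnergy, finiteFreeEnergy, ← mul_sub, abs_mul, abs_of_nonneg (by positivity)]
  refine (mul_le_mul_of_nonneg_left this (by positivity)).trans (le_of_eq ?_)
  rw [div_eq_inv_mul, mul_assoc]

lemma abs_finiteHamiltonian_update_sub_le [CompactSpace ↥S] (ψ : C(↥S, ℝ)) {n : ℕ}
    (x : Fin n → C((Fin p → ↥S), ℝ) × (Fin p → Fin N)) (k : Fin n)
    (b : C((Fin p → ↥S), ℝ) × (Fin p → Fin N)) (σ : Fin N → ↥S) :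
    |finiteHamiltonian ψ (Function.update x k b) σ - finiteHamiltonian ψ x σ|
      ≤ ‖b.1‖ + ‖(x k).1‖ := by
  have : finiteHamiltonian ψ (Function.update x k b) σ - finiteHamiltonian ψ x σ
      = b.1 (fun j => σ (b.2 j)) - (x k).1 (fun j => σ ((x k).2 j)) := by
    rw [finiteHamiltonian, finiteHamiltonian, add_sub_add_right_eq_sub, ← Finset.sum_sub_distrib,
      Finset.sum_eq_single k]
    · simp
    · intro i _ hi
      simp [Function.update_of_ne hi]
    · simp
  rw [this]
  refine (abs_sub _ _).trans ?_
  gcongr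
  exacts [b.1.norm_coe_le_norm _, (x k).1.norm_coe_le_norm _]

lemma abs_finiteHamiltonian_cons_sub_le [CompactSpace ↥S] (ψ : C(↥S, ℝ)) {n : ℕ}
    (a : C((Fin p → ↥S), ℝ) × (Fin p → Fin N))
    (y : Fin n → C((Fin p → ↥S), ℝ) × (Fin p → Fin N)) (σ : Fin N → ↥S) :
    |finiteHamiltonian ψ (Fin.cons a y : Fin (n + 1) → _) σ - finiteHamiltonian ψ y σ|
      ≤ ‖a.1‖ := by
  rw [finiteHamiltonian, finiteHamiltonian, add_sub_add_right_eq_sub, Fin.sum_univ_succ]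
  simp only [Fin.cons_zero, Fin.cons_succ, add_sub_cancel_right]
  exact a.1.norm_coe_le_norm _

lemma measurable_finiteFreeEnergy [CompactSpace ↥S] [MeasurableSpace C((Fin p → ↥S), ℝ)]
    [BorelSpace C((Fin p → ↥S), ℝ)] (β : ℝ) (ψ : C(↥S, ℝ)) (ν : Measure ↥S)
    [IsProbabilityMeasure ν] (n : ℕ) :
    Measurable (finiteFreeEnergy (p := p) (N := N) β ψ ν n) := by
  have hev : Measurable fun q : C((Fin p → ↥S), ℝ) × (Fin p → ↥S) => q.1 q.2 :=
    ContinuousEval.continuous_eval.measurable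
  have hsel : Measurable fun q : (Fin N → ↥S) × Fin N => q.1 q.2 :=
    measurable_from_prod_countable_left fun i => measurable_pi_apply i
  have hH : Measurable fun q : (Fin n → C((Fin p → ↥S), ℝ) × (Fin p → Fin N)) × (Fin N → ↥S) =>
      finiteHamiltonian ψ q.1 q.2 := by
    unfold finiteHamiltonian
    refine (Finset.measurable_sum _ fun k _ => ?_).add (Finset.measurable_sum _ fun i _ => ?_)
    · refine hev.comp (Measurable.prodMk (by fun_prop) (measurable_pi_iff.2 fun j => ?_))
      exact hsel.comp (Measurable.prodMk (by fun_prop) (by fun_prop))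
    · exact ψ.continuous.measurable.comp (by fun_prop)
  have hint := (Real.measurable_exp.comp (hH.const_mul β)).stronglyMeasurable.integral_prod_right'
    (ν := Measure.pi fun _ : Fin N => ν)
  exact (Real.measurable_log.comp hint.measurable).const_mul _

end FreeEnergy

/-- Concentration of the free energy: for every `β > 0` there is a constant
`K > 0`, depending only on `α` and `β`, such that for every choice of `Σ`, `ν`, `ψ`, `μθ`
and every `N`, `E|F_N(β) - E F_N(β)| ≤ K N^{-1/2} (∫ ‖θ‖∞² μθ(dθ))^{1/2}`. -/
theorem free_energy_concentration (p : ℕ) (hp : 2 ≤ p) (α : ℝ≥0) (hα : 0 < α)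
    (β : ℝ) (hβ : 0 < β) :
    ∃ Kc : ℝ, 0 < Kc ∧
      ∀ (R : ℝ), 0 < R →
      ∀ (S : Set ℝ) [CompactSpace ↥S] [Nonempty ↥S], S ⊆ Set.Icc (-R) R →
      ∀ (ν : Measure ↥S) [IsProbabilityMeasure ν],
      ∀ (ψ : C(↥S, ℝ)) (Lψ : ℝ≥0), LipschitzWith Lψ ψ →
      ∀ [MeasurableSpace C((Fin p → ↥S), ℝ)] [BorelSpace C((Fin p → ↥S), ℝ)]
        (μθ : Measure C((Fin p → ↥S), ℝ)) [IsProbabilityMeasure μθ],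
        Integrable (fun θ : C((Fin p → ↥S), ℝ) => ‖θ‖ ^ 2) μθ →
      ∀ (Ω : ℕ → Type) [∀ N, MeasureSpace (Ω N)]
        [∀ N, IsProbabilityMeasure (ℙ : Measure (Ω N))]
        (K : ∀ N, Ω N → ℕ) (θR : ∀ N, ℕ → Ω N → C((Fin p → ↥S), ℝ))
        (IR : ∀ N, ℕ → Ω N → (Fin p → Fin N)),
        (∀ N, p ≤ N → ∀ n : ℕ,
          Measure.map (fun ω => (K N ω, fun k : Fin n => (θR N k ω, IR N k ω))) ℙ
            = (ProbabilityTheory.poissonMeasure (α * N)).prod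
                (Measure.pi fun _ : Fin n =>
                  μθ.prod (ProbabilityTheory.uniformOn
                    {f : Fin p → Fin N | Function.Injective f}))) →
      ∀ N : ℕ, p ≤ N →
        (∫ ω, |freeEnergy p N β ψ ν (K N) (θR N) (IR N) ω
            - ∫ ω', freeEnergy p N β ψ ν (K N) (θR N) (IR N) ω' ∂ℙ| ∂ℙ)
          ≤ Kc / Real.sqrt N * Real.sqrt (∫ θ, ‖θ‖ ^ 2 ∂μθ) := by
  refine ⟨β * √(5 * α), by positivity, ?_⟩
  intro R _ S _ _ _ ν _ ψ _ _ _ _ μθ _ hθ Ω _ _ K θR IR hlaw N hpN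
  have hN : (0 : ℝ) < N := by exact_mod_cast (by omega : 0 < N)
  have hU : IsProbabilityMeasure (ProbabilityTheory.uniformOn
      {f : Fin p → Fin N | Function.Injective f}) :=
    ProbabilityTheory.isProbabilityMeasure_uniformOn (Set.toFinite _)
      ⟨Fin.castLE hpN, Fin.castLE_injective hpN⟩
  set d : C((Fin p → ↥S), ℝ) × (Fin p → Fin N) → ℝ := fun a => β / N * ‖a.1‖ with hd
  have hdL : MemLp d 2 (μθ.prod (ProbabilityTheory.uniformOn
      {f : Fin p → Fin N | Function.Injective f})) := by
    have hnorm : MemLp (fun θ : C((Fin p → ↥S), ℝ) => ‖θ‖) 2 μθ :=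
      (memLp_two_iff_integrable_sq continuous_norm.measurable.aestronglyMeasurable).2 hθ
    exact (hnorm.const_mul (β / N)).comp_measurePreserving measurePreserving_fst
  have hd2 : ∫ a, d a ^ 2 ∂(μθ.prod (ProbabilityTheory.uniformOn
      {f : Fin p → Fin N | Function.Injective f})) = (β / N) ^ 2 * ∫ θ, ‖θ‖ ^ 2 ∂μθ := by
    have h := integral_fun_fst (μ := μθ) (ν := ProbabilityTheory.uniformOn
      {f : Fin p → Fin N | Function.Injective f}) fun θ => (β / N * ‖θ‖) ^ 2
    rw [h, ← integral_const_mul]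
    simp [mul_pow]
  have h := integral_abs_sub_integral_le_of_poisson hdL
    (G := finiteFreeEnergy β ψ ν) (measurable_finiteFreeEnergy β ψ ν)
    (fun n x k b => (abs_finiteFreeEnergy_sub_le hβ.le ψ
      (abs_finiteHamiltonian_update_sub_le ψ x k b)).trans (le_of_eq (mul_add _ _ _)))
    (fun n a y => abs_finiteFreeEnergy_sub_le hβ.le ψ (abs_finiteHamiltonian_cons_sub_le ψ a y))
    (Y := fun k ω => (θR N k ω, IR N k ω)) (hlaw N hpN)
    (freeEnergy_eq_finiteFreeEnergy β ψ ν (K N) (θR N) (IR N))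
  refine h.trans (le_of_eq ?_)
  rw [hd2]
  have hM : 0 ≤ ∫ θ, ‖θ‖ ^ 2 ∂μθ := integral_nonneg fun _ => sq_nonneg _
  generalize ∫ θ, ‖θ‖ ^ 2 ∂μθ = M at hM ⊢
  have harg : 5 * ((α * N : ℝ≥0) : ℝ) * ((β / N) ^ 2 * M) = β ^ 2 * (5 * α) / N * M := by
    push_cast
    field_simp
  rw [harg, Real.sqrt_mul (by positivity), Real.sqrt_div (by positivity),
    Real.sqrt_mul (by positivity), Real.sqrt_sq hβ.le]

end DilutedSpinGlass
end

section
/- Let α > 0 and let p ≥ 2 be an integer with αp(p−1) ≤ 1. Then c = 1 is the unique solution in [0,1] of the equation c = exp(αp(c^{p−1} − 1)). -/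
/-- Let `α > 0` and let `p ≥ 2` be an integer with `α p (p-1) ≤ 1`.
Then `c = 1` is the unique solution in `[0,1]` of `c = exp (α p (c^(p-1) - 1))`. -/
theorem unique_solution_subcritical (α : ℝ) (p : ℕ) (hα : 0 < α) (hp : 2 ≤ p)
    (hsub : α * p * ((p : ℝ) - 1) ≤ 1) :
    ∀ c ∈ Set.Icc (0 : ℝ) 1,
      (c = Real.exp (α * p * (c ^ (p - 1) - 1)) ↔ c = 1) := by
  intro c hc
  refine ⟨fun h => ?_, fun h => by simp [h]⟩
  by_contra hne
  obtain ⟨n, rfl⟩ : ∃ n, p = n + 1 := ⟨p - 1, by omega⟩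
  have hn : n ≠ 0 := by omega
  rw [Nat.add_sub_cancel] at h
  have hpos : 0 < c := h ▸ Real.exp_pos _
  have hlt : c < 1 := lt_of_le_of_ne hc.2 hne
  have hpow : c ^ n < 1 := pow_lt_one₀ hpos.le hlt hn
  have hlog : Real.log c = α * ((n + 1 : ℕ) : ℝ) * (c ^ n - 1) := by
    conv_lhs => rw [h, Real.log_exp]
  have hstrict := Real.log_lt_sub_one_of_pos (pow_pos hpos n) hpow.ne
  rw [Real.log_pow, hlog] at hstrict
  push_cast at hsub hstrict
  nlinarith [mul_nonneg (sub_nonneg.2 hsub) (sub_nonneg.2 hpow.le)]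
end

section
/- Let r ≥ 0 be an integer, θ₁,…,θ_r ∈ C(Σ^p,ℝ) with Lip(θ_k) < ∞ for all k, and let w : Σ^{r(p−1)} → (0,∞) be measurable with 0 < ∫ w dν^{⊗r(p−1)} < ∞. Define T : Σ → ℝ by T(t) = (1/β)·log[ ∫ E_{β,r}(σ,t) w(σ) ν^{⊗r(p−1)}(dσ) / ∫∫ E_{β,r}(σ,s) w(σ) ν^{⊗r(p−1)}(dσ) ν(ds) ]. Then sup_{t∈Σ}|T(t)| ≤ 2·Σ_{k=1}^r ‖θ_k‖∞ + 2‖ψ‖∞, and T is Lipschitz with Lip(T) ≤ Σ_{k=1}^r Lip(θ_k) + Lip(ψ). -/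
open MeasureTheory

/-- The Boltzmann factor `E_{β,r}(σ,t)
  = exp(β Σ_{k<r} θ_k(σ_{k,1},…,σ_{k,p-1},t) + β ψ(t))`,
with the `r(p-1)` cavity coordinates indexed by pairs `(k, j) ∈ Fin r × Fin (p-1)`. -/
noncomputable def cavityFactor (p : ℕ) {S : Set ℝ} (β : ℝ) (ψ : C(↥S, ℝ)) {r : ℕ}
    (θv : Fin r → C((Fin p → ↥S), ℝ)) (σ : Fin r × Fin (p - 1) → ↥S) (t : ↥S) : ℝ :=
  Real.exp (β * ((∑ k : Fin r,
    θv k (fun j : Fin p => if h : (j : ℕ) < p - 1 then σ (k, ⟨(j : ℕ), h⟩) else t)) + ψ t))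

/-- A function `f` with values in `[a, b]` has its integral against a nonnegative integrable
weight `w` in `[a ∫ w, b ∫ w]`, and `f * w` is integrable. -/
lemma integral_mul_weight_mem_Icc {α : Type*} [MeasurableSpace α] {μ : Measure α} {f w : α → ℝ}
    {a b : ℝ} (hf : AEStronglyMeasurable f μ) (ha : ∀ x, a ≤ f x) (hb : ∀ x, f x ≤ b)
    (hw : Integrable w μ) (hw0 : ∀ x, 0 ≤ w x) :
    Integrable (fun x => f x * w x) μ ∧
      ∫ x, f x * w x ∂μ ∈ Set.Icc (a * ∫ x, w x ∂μ) (b * ∫ x, w x ∂μ) := by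
  have hint : Integrable (fun x => f x * w x) μ :=
    hw.bdd_mul (c := max |a| |b|) hf
      (Filter.Eventually.of_forall fun x => abs_le_max_abs_abs (ha x) (hb x))
  refine ⟨hint, ?_, ?_⟩
  · rw [← integral_const_mul]
    exact integral_mono (hw.const_mul a) hint
      fun x => mul_le_mul_of_nonneg_right (ha x) (hw0 x)
  · rw [← integral_const_mul]
    exact integral_mono hint (hw.const_mul b)
      fun x => mul_le_mul_of_nonneg_right (hb x) (hw0 x)

/-- If `u, v ∈ [exp (-c) W, exp c W]` with `W > 0`, then `|log (u / v)| ≤ 2 c`. -/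
lemma abs_log_div_le_of_mem_Icc_exp {u v W c : ℝ} (hW : 0 < W)
    (hu : u ∈ Set.Icc (Real.exp (-c) * W) (Real.exp c * W))
    (hv : v ∈ Set.Icc (Real.exp (-c) * W) (Real.exp c * W)) :
    |Real.log (u / v)| ≤ 2 * c := by
  have key : ∀ z ∈ Set.Icc (Real.exp (-c) * W) (Real.exp c * W),
      0 < z ∧ -c + Real.log W ≤ Real.log z ∧ Real.log z ≤ c + Real.log W := by
    intro z hz
    have hpos : 0 < Real.exp (-c) * W := by positivity
    have hz0 : 0 < z := hpos.trans_le hz.1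
    have h1 := Real.log_le_log hpos hz.1
    have h2 := Real.log_le_log hz0 hz.2
    rw [Real.log_mul (Real.exp_ne_zero _) hW.ne', Real.log_exp] at h1 h2
    exact ⟨hz0, h1, h2⟩
  obtain ⟨hu0, hu1, hu2⟩ := key u hu
  obtain ⟨hv0, hv1, hv2⟩ := key v hv
  rw [Real.log_div hu0.ne' hv0.ne', abs_le]
  constructor <;> linarith

/-- The Boltzmann factor is jointly continuous. -/
lemma continuous_uncurry_cavityFactor (p : ℕ) {S : Set ℝ} (β : ℝ) (ψ : C(↥S, ℝ)) {r : ℕ}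
    (θv : Fin r → C((Fin p → ↥S), ℝ)) :
    Continuous (Function.uncurry (cavityFactor p β ψ θv)) := by
  unfold cavityFactor Function.uncurry
  refine Real.continuous_exp.comp (continuous_const.mul
    ((continuous_finsetSum _ fun k _ => (θv k).continuous.comp ?_).add
      (ψ.continuous.comp continuous_snd)))
  refine continuous_pi fun j => ?_
  split_ifs <;> fun_prop

/-- The Boltzmann factor lies between `exp (-β M)` and `exp (β M)`, `M = Σ ‖θ_k‖ + ‖ψ‖`. -/
lemma cavityFactor_mem_Icc (p : ℕ) {S : Set ℝ} [CompactSpace ↥S] {β : ℝ} (hβ : 0 ≤ β)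
    (ψ : C(↥S, ℝ)) {r : ℕ} (θv : Fin r → C((Fin p → ↥S), ℝ)) (σ : Fin r × Fin (p - 1) → ↥S)
    (t : ↥S) :
    cavityFactor p β ψ θv σ t ∈ Set.Icc (Real.exp (-(β * ((∑ k, ‖θv k‖) + ‖ψ‖))))
      (Real.exp (β * ((∑ k, ‖θv k‖) + ‖ψ‖))) := by
  have h : |(∑ k : Fin r,
      θv k (fun j : Fin p => if h : (j : ℕ) < p - 1 then σ (k, ⟨(j : ℕ), h⟩) else t)) + ψ t|
        ≤ (∑ k, ‖θv k‖) + ‖ψ‖ :=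
    (abs_add_le _ _).trans (add_le_add ((Finset.abs_sum_le_sum_abs _ _).trans
      (Finset.sum_le_sum fun k _ => (θv k).norm_coe_le_norm _)) (ψ.norm_coe_le_norm t))
  rw [abs_le] at h
  refine ⟨Real.exp_le_exp.2 ?_, Real.exp_le_exp.2 (mul_le_mul_of_nonneg_left h.2 hβ)⟩
  rw [← mul_neg]
  exact mul_le_mul_of_nonneg_left h.1 hβ

/-- Changing only the last argument of the Boltzmann factor costs at most a factor
`exp (β L |x - y|)`, where `L = Σ Lip(θ_k) + Lip(ψ)`. -/
lemma cavityFactor_le_exp_mul (p : ℕ) (hp : 1 ≤ p) {S : Set ℝ} {β : ℝ} (hβ : 0 ≤ β)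
    (ψ : C(↥S, ℝ)) {Lψ : ℝ} (hψLip : ∀ x y : ↥S, |ψ x - ψ y| ≤ Lψ * |(x : ℝ) - (y : ℝ)|)
    {r : ℕ} (θv : Fin r → C((Fin p → ↥S), ℝ)) {Lθ : Fin r → ℝ}
    (hθLip : ∀ k, ∀ x y : Fin p → ↥S,
      |θv k x - θv k y| ≤ Lθ k * Real.sqrt (∑ j, ((x j : ℝ) - (y j : ℝ)) ^ 2))
    (σ : Fin r × Fin (p - 1) → ↥S) (x y : ↥S) :
    cavityFactor p β ψ θv σ x ≤
      Real.exp (β * (((∑ k, Lθ k) + Lψ) * |(x : ℝ) - (y : ℝ)|)) * cavityFactor p β ψ θv σ y := by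
  unfold cavityFactor
  rw [← Real.exp_add, ← mul_add]
  refine Real.exp_le_exp.2 (mul_le_mul_of_nonneg_left ?_ hβ)
  have hθ : ∀ k : Fin r,
      θv k (fun j : Fin p => if h : (j : ℕ) < p - 1 then σ (k, ⟨(j : ℕ), h⟩) else x) ≤
      Lθ k * |(x : ℝ) - (y : ℝ)| +
        θv k (fun j : Fin p => if h : (j : ℕ) < p - 1 then σ (k, ⟨(j : ℕ), h⟩) else y) := by
    intro k
    have h := (le_abs_self _).trans (hθLip k
      (fun j : Fin p => if h : (j : ℕ) < p - 1 then σ (k, ⟨(j : ℕ), h⟩) else x)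
      (fun j : Fin p => if h : (j : ℕ) < p - 1 then σ (k, ⟨(j : ℕ), h⟩) else y))
    rw [Finset.sum_eq_single (⟨p - 1, by omega⟩ : Fin p)] at h
    · simp only [lt_irrefl, dite_false, Real.sqrt_sq_eq_abs] at h
      linarith
    · intro j _ hj
      have hlt : (j : ℕ) < p - 1 := by
        have := j.isLt
        have : (j : ℕ) ≠ p - 1 := fun h => hj (Fin.ext h)
        omega
      simp [hlt]
    · simp
  have hsum := Finset.sum_le_sum fun k (_ : k ∈ Finset.univ) => hθ k
  rw [Finset.sum_add_distrib, ← Finset.sum_mul] at hsum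
  have hψ := (le_abs_self _).trans (hψLip x y)
  rw [add_mul]
  linarith

/-- bounds on the sup-norm and the Lipschitz constant of the cavity function
`T(t) = β⁻¹ log ( ∫ E_{β,r}(σ,t) w(σ) dν^{⊗r(p-1)} / ∫∫ E_{β,r}(σ,s) w(σ) dν^{⊗r(p-1)} ν(ds) )`:
`sup_t |T(t)| ≤ 2 Σ_k ‖θ_k‖∞ + 2‖ψ‖∞` and `Lip(T) ≤ Σ_k Lip(θ_k) + Lip(ψ)`. -/
theorem cavity_function_bounds (p : ℕ) (hp : 2 ≤ p) (R : ℝ) (hR : 0 < R)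
    (S : Set ℝ) [CompactSpace ↥S] [Nonempty ↥S] (hSR : S ⊆ Set.Icc (-R) R)
    (ν : Measure ↥S) [IsProbabilityMeasure ν]
    (β : ℝ) (hβ : 0 < β)
    (ψ : C(↥S, ℝ)) (Lψ : ℝ) (hLψ : 0 ≤ Lψ)
    (hψLip : ∀ x y : ↥S, |ψ x - ψ y| ≤ Lψ * |(x : ℝ) - (y : ℝ)|)
    (r : ℕ) (θv : Fin r → C((Fin p → ↥S), ℝ)) (Lθ : Fin r → ℝ) (hLθ : ∀ k, 0 ≤ Lθ k)
    (hθLip : ∀ k, ∀ x y : Fin p → ↥S,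
      |θv k x - θv k y| ≤ Lθ k * Real.sqrt (∑ j, ((x j : ℝ) - (y j : ℝ)) ^ 2))
    (w : (Fin r × Fin (p - 1) → ↥S) → ℝ) (hwmeas : Measurable w) (hwpos : ∀ σ, 0 < w σ)
    (hwint : IntegrableOn w Set.univ (Measure.pi fun _ : Fin r × Fin (p - 1) => ν))
    (hwpos' : 0 < ∫ σ, w σ ∂(Measure.pi fun _ : Fin r × Fin (p - 1) => ν))
    (T : ↥S → ℝ)
    (hT : ∀ t, T t = (1 / β) * Real.log
      ((∫ σ, cavityFactor p β ψ θv σ t * w σ ∂(Measure.pi fun _ : Fin r × Fin (p - 1) => ν)) /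
        (∫ σ, (∫ s, cavityFactor p β ψ θv σ s ∂ν) * w σ
          ∂(Measure.pi fun _ : Fin r × Fin (p - 1) => ν)))) :
    (∀ t : ↥S, |T t| ≤ 2 * (∑ k, ‖θv k‖) + 2 * ‖ψ‖) ∧
    (∀ x y : ↥S, |T x - T y| ≤ ((∑ k, Lθ k) + Lψ) * |(x : ℝ) - (y : ℝ)|) := by
  set μ : Measure (Fin r × Fin (p - 1) → ↥S) := Measure.pi fun _ => ν
  set M : ℝ := (∑ k, ‖θv k‖) + ‖ψ‖
  have hw : Integrable w μ := integrableOn_univ.1 hwint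
  have hcont := continuous_uncurry_cavityFactor p β ψ θv
  have hmem := cavityFactor_mem_Icc p hβ.le ψ θv
  have hnum : ∀ t, Integrable (fun σ => cavityFactor p β ψ θv σ t * w σ) μ ∧
      ∫ σ, cavityFactor p β ψ θv σ t * w σ ∂μ ∈
        Set.Icc (Real.exp (-(β * M)) * ∫ σ, w σ ∂μ) (Real.exp (β * M) * ∫ σ, w σ ∂μ) := fun t =>
    integral_mul_weight_mem_Icc
      (hcont.comp (Continuous.prodMk_left t)).measurable.aestronglyMeasurable
      (fun σ => (hmem σ t).1) (fun σ => (hmem σ t).2) hw (fun σ => (hwpos σ).le)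
  have hinner : ∀ σ, ∫ s, cavityFactor p β ψ θv σ s ∂ν ∈
      Set.Icc (Real.exp (-(β * M))) (Real.exp (β * M)) := fun σ => by
    simpa using (integral_mul_weight_mem_Icc (μ := ν) (w := fun _ => 1)
      (hcont.comp (Continuous.prodMk_right σ)).measurable.aestronglyMeasurable
      (fun s => (hmem σ s).1) (fun s => (hmem σ s).2) (integrable_const _)
      (fun _ => zero_le_one)).2
  have hden := (integral_mul_weight_mem_Icc (μ := μ)
    hcont.measurable.stronglyMeasurable.integral_prod_right.aestronglyMeasurable
    (fun σ => (hinner σ).1) (fun σ => (hinner σ).2) hw (fun σ => (hwpos σ).le)).2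
  have hpos : 0 < Real.exp (-(β * M)) * ∫ σ, w σ ∂μ := mul_pos (Real.exp_pos _) hwpos'
  have hden0 := hpos.trans_le hden.1
  refine ⟨fun t => ?_, ?_⟩
  · have h := abs_log_div_le_of_mem_Icc_exp hwpos' (hnum t).2 hden
    rw [hT t, abs_mul, abs_of_pos (one_div_pos.2 hβ), ← mul_add, one_div,
      inv_mul_le_iff₀ hβ]
    exact h.trans_eq (by ring)
  · have hle : ∀ x y : ↥S, T x - T y ≤ ((∑ k, Lθ k) + Lψ) * |(x : ℝ) - (y : ℝ)| := by
      intro x y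
      have hx0 := hpos.trans_le (hnum x).2.1
      have hy0 := hpos.trans_le (hnum y).2.1
      have hxy : ∫ σ, cavityFactor p β ψ θv σ x * w σ ∂μ ≤
          Real.exp (β * (((∑ k, Lθ k) + Lψ) * |(x : ℝ) - (y : ℝ)|)) *
            ∫ σ, cavityFactor p β ψ θv σ y * w σ ∂μ := by
        rw [← integral_const_mul]
        refine integral_mono (hnum x).1 ((hnum y).1.const_mul _) fun σ => ?_
        exact (mul_le_mul_of_nonneg_right (cavityFactor_le_exp_mul p (by omega) hβ.le ψ hψLip θv
          hθLip σ x y) (hwpos σ).le).trans_eq (mul_assoc _ _ _)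
      have hlog := Real.log_le_log hx0 hxy
      rw [Real.log_mul (Real.exp_ne_zero _) hy0.ne', Real.log_exp] at hlog
      rw [hT x, hT y, ← mul_sub, Real.log_div hx0.ne' hden0.ne',
        Real.log_div hy0.ne' hden0.ne', one_div, inv_mul_le_iff₀ hβ]
      linarith
    intro x y
    rw [abs_sub_le_iff]
    exact ⟨hle x y, abs_sub_comm (x : ℝ) y ▸ hle y x⟩
end
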